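/- arXiv:2409.03128 — 2 statements merged into one kernel-verified Lean document; each statement's English description precedes it below -/
import Mathlib

section
/- (Shakan) There exist constants C > 0 and c ≥ 0 such that for every finite set A ⊆ ℝ with |A| ≥ 2 there is a subset A' ⊆ A with |A'| ≥ |A|/2 and min{E⁺(A'), Eˣ(A')} ≤ C · |A|^{3 − 7/26} · (log |A|)^{c}. -/
/-- The additive energy of a finite set: the number of quadruples
`(a, b, a', b') ∈ A⁴` with `a + b = a' + b'`. -/
noncomputable def addEnergy {α : Type*} [Add α] [DecidableEq α] (A : Finset α) : ℕ :=
  ((A ×ˢ A ×ˢ A ×ˢ A).filter (fun x => x.1 + x.2.1 = x.2.2.1 + x.2.2.2)).card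

/-- The multiplicative energy of a finite set: the number of quadruples
`(a, b, a', b') ∈ A⁴` with `a · b = a' · b'`. -/
noncomputable def mulEnergy {α : Type*} [Mul α] [DecidableEq α] (A : Finset α) : ℕ :=
  ((A ×ˢ A ×ˢ A ×ˢ A).filter (fun x => x.1 * x.2.1 = x.2.2.1 * x.2.2.2)).card

section EnergyDecomposition

open Finset

/-- The number of elements of `B` strictly below `b`. -/
noncomputable def rankIn (B : Finset ℝ) (b : ℝ) : ℕ := #{x ∈ B | x < b}

theorem rankIn_mono (B : Finset ℝ) : Monotone (rankIn B) := fun _ _ h =>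
  card_le_card fun x hx => by
    simp only [mem_filter] at hx ⊢
    exact ⟨hx.1, hx.2.trans_le h⟩

theorem rankIn_lt_rankIn {B : Finset ℝ} {b b' : ℝ} (hb : b ∈ B) (h : b < b') :
    rankIn B b < rankIn B b' :=
  card_lt_card <| by
    refine (ssubset_iff_of_subset fun x hx => ?_).2 ⟨b, ?_, ?_⟩
    · simp only [mem_filter] at hx ⊢
      exact ⟨hx.1, hx.2.trans h⟩
    · simp [hb, h]
    · simp

theorem rankIn_injOn (B : Finset ℝ) : Set.InjOn (rankIn B) B := by
  intro b hb b' hb' h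
  rcases lt_trichotomy b b' with hlt | rfl | hlt
  · exact absurd h (rankIn_lt_rankIn hb hlt).ne
  · rfl
  · exact absurd h (rankIn_lt_rankIn hb' hlt).ne'

theorem rankIn_le_card (B : Finset ℝ) (b : ℝ) : rankIn B b ≤ #B := card_filter_le _ _

theorem card_rankIn_div_eq_le (B : Finset ℝ) {k : ℕ} (hk : 0 < k) (i : ℕ) :
    #{b ∈ B | rankIn B b / k = i} ≤ k := by
  calc #{b ∈ B | rankIn B b / k = i}
      ≤ #(Ico (i * k) (i * k + k)) := by
        refine card_le_card_of_injOn (rankIn B) (fun b hb => ?_)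
          ((rankIn_injOn B).mono (coe_subset.2 (filter_subset _ _)))
        have hi : rankIn B b / k = i := (mem_filter.1 hb).2
        have h1 := Nat.div_add_mod (rankIn B b) k
        have h2 := Nat.mod_lt (rankIn B b) hk
        rw [hi, mul_comm] at h1
        simp only [coe_Ico, Set.mem_Ico]
        constructor <;> linarith [Nat.zero_le (rankIn B b % k)]
    _ = k := by simp

theorem card_le_card_image_add_card_pairs {ι κ : Type*} [DecidableEq ι] [DecidableEq κ]
    (s : Finset ι) (f : ι → κ) :
    #s ≤ #(s.image f) + #{p ∈ s.offDiag | f p.1 = f p.2} := by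
  have h2 : #{p ∈ s.offDiag | f p.1 = f p.2} =
      ∑ y ∈ s.image f, #{p ∈ {p ∈ s.offDiag | f p.1 = f p.2} | f p.1 = y} := by
    refine card_eq_sum_card_fiberwise fun p hp => ?_
    simp only [coe_filter, mem_offDiag, Set.mem_ofPred_eq] at hp
    exact mem_coe.2 (mem_image_of_mem f hp.1.1)
  rw [h2, card_eq_sum_card_image f s, card_eq_sum_ones, ← sum_add_distrib]
  refine sum_le_sum fun y _ => ?_
  have h3 : (({i ∈ s | f i = y} : Finset ι).offDiag) ⊆
      {p ∈ {p ∈ s.offDiag | f p.1 = f p.2} | f p.1 = y} := by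
    intro p hp
    simp only [mem_offDiag, mem_filter] at hp ⊢
    obtain ⟨⟨h1, h2⟩, ⟨h3, h4⟩, h5⟩ := hp
    exact ⟨⟨⟨h1, h3, h5⟩, h2.trans h4.symm⟩, h2⟩
  refine le_trans ?_ (Nat.add_le_add_left (card_le_card h3) 1)
  rw [offDiag_card]
  generalize #{i ∈ s | f i = y} = n
  rcases n with _ | _ | n
  · simp
  · simp
  · have : (n + 1 + 1) * (n + 1 + 1) - (n + 1 + 1) = (n + 1) * (n + 2) := by
      rw [← Nat.sub_one_mul]; rfl
    nlinarith

/-- Points of the grid `B × S` lying on the line `y * c = x + b`. -/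
noncomputable def pointsOn (B S : Finset ℝ) (l : ℝ × ℝ) : Finset (ℝ × ℝ) :=
  {p ∈ B ×ˢ S | p.2 * l.1 = l.2 + p.1}

theorem card_image_cell_le (B S : Finset ℝ) {l : ℝ × ℝ} (hl : l.1 ≠ 0) (k m : ℕ) :
    #((pointsOn B S l).image fun p => (rankIn B p.1 / k, rankIn S p.2 / m)) ≤
      #B / k + #S / m + 1 := by
  have hB : ∀ b, rankIn B b / k ≤ #B / k := fun b => Nat.div_le_div_right (rankIn_le_card B b)
  have hS : ∀ b, rankIn S b / m ≤ #S / m := fun b => Nat.div_le_div_right (rankIn_le_card S b)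
  have mB : ∀ {b b'}, b ≤ b' → rankIn B b / k ≤ rankIn B b' / k :=
    fun h => Nat.div_le_div_right (rankIn_mono B h)
  have mS : ∀ {b b'}, b ≤ b' → rankIn S b / m ≤ rankIn S b' / m :=
    fun h => Nat.div_le_div_right (rankIn_mono S h)
  rw [← card_range (#B / k + #S / m + 1)]
  rcases lt_or_gt_of_ne hl with hneg | hpos
  · refine card_le_card_of_injOn (fun q => q.1 + (#S / m - q.2)) ?_ ?_
    · intro q hq
      obtain ⟨p, -, rfl⟩ := mem_image.1 (mem_coe.1 hq)
      have := hB p.1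
      simp only [coe_range, Set.mem_Iio]
      lia
    · intro q hq q' hq' h
      obtain ⟨p, hp, rfl⟩ := mem_image.1 (mem_coe.1 hq)
      obtain ⟨p', hp', rfl⟩ := mem_image.1 (mem_coe.1 hq')
      have e := (mem_filter.1 hp).2
      have e' := (mem_filter.1 hp').2
      have := hS p.2
      have := hS p'.2
      dsimp only at h
      rcases le_total p.2 p'.2 with hy | hy
      · have := mS hy
        have := mB (show p'.1 ≤ p.1 by nlinarith)
        ext <;> simp only <;> lia
      · have := mS hy
        have := mB (show p.1 ≤ p'.1 by nlinarith)
        ext <;> simp only <;> lia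
  · refine card_le_card_of_injOn (fun q => q.1 + q.2) ?_ ?_
    · intro q hq
      obtain ⟨p, -, rfl⟩ := mem_image.1 (mem_coe.1 hq)
      have := hB p.1
      have := hS p.2
      simp only [coe_range, Set.mem_Iio]
      lia
    · intro q hq q' hq' h
      obtain ⟨p, hp, rfl⟩ := mem_image.1 (mem_coe.1 hq)
      obtain ⟨p', hp', rfl⟩ := mem_image.1 (mem_coe.1 hq')
      have e := (mem_filter.1 hp).2
      have e' := (mem_filter.1 hp').2
      dsimp only at h
      rcases le_total p.2 p'.2 with hy | hy
      · have := mS hy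
        have := mB (show p.1 ≤ p'.1 by nlinarith)
        ext <;> simp only <;> lia
      · have := mS hy
        have := mB (show p'.1 ≤ p.1 by nlinarith)
        ext <;> simp only <;> lia

theorem sum_card_pointsOn_le (B S : Finset ℝ) {L : Finset (ℝ × ℝ)} (hL : ∀ l ∈ L, l.1 ≠ 0)
    {k m : ℕ} (hk : 0 < k) (hm : 0 < m) :
    ∑ l ∈ L, #(pointsOn B S l) ≤ #L * (#B / k + #S / m + 1) + #B * #S * (k * m) := by
  set κ : ℝ × ℝ → ℕ × ℕ := fun p => (rankIn B p.1 / k, rankIn S p.2 / m) with hκ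
  have h1 : ∑ l ∈ L, #(pointsOn B S l) ≤ ∑ l ∈ L, ((#B / k + #S / m + 1) +
      #{p ∈ (pointsOn B S l).offDiag | κ p.1 = κ p.2}) :=
    sum_le_sum fun l hl => (card_le_card_image_add_card_pairs (pointsOn B S l) κ).trans
      (Nat.add_le_add_right (card_image_cell_le B S (hL l hl) k m) _)
  refine h1.trans ?_
  rw [sum_add_distrib, sum_const, smul_eq_mul]
  refine Nat.add_le_add_left ?_ _
  have h2 : ∑ l ∈ L, #{p ∈ (pointsOn B S l).offDiag | κ p.1 = κ p.2} ≤
      #{p ∈ (B ×ˢ S) ×ˢ (B ×ˢ S) | κ p.1 = κ p.2} := by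
    rw [← card_biUnion]
    · refine card_le_card fun p hp => ?_
      simp only [mem_biUnion, mem_filter, mem_offDiag, pointsOn] at hp
      obtain ⟨l, -, ⟨⟨h1, -⟩, ⟨h2, -⟩, -⟩, h3⟩ := hp
      exact mem_filter.2 ⟨mem_product.2 ⟨h1, h2⟩, h3⟩
    · intro l hl l' hl' hne
      refine disjoint_left.2 fun p hp hp' => hne ?_
      simp only [mem_filter, mem_offDiag, pointsOn] at hp hp'
      obtain ⟨⟨⟨-, e1⟩, ⟨-, e2⟩, hpp⟩, -⟩ := hp
      obtain ⟨⟨⟨-, e3⟩, ⟨-, e4⟩, -⟩, -⟩ := hp'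
      have hy : p.1.2 - p.2.2 ≠ 0 := by
        intro h
        have h : p.1.2 = p.2.2 := sub_eq_zero.1 h
        refine hpp (Prod.ext ?_ h)
        rw [h] at e1
        linarith
      have hc : l.1 = l'.1 := mul_left_cancel₀ hy (by linarith)
      refine Prod.ext hc ?_
      rw [hc] at e1
      linarith
  refine h2.trans ?_
  have h3 : #{p ∈ (B ×ˢ S) ×ˢ (B ×ˢ S) | κ p.1 = κ p.2} =
      ∑ q ∈ B ×ˢ S, #{p ∈ B ×ˢ S | κ p = κ q} := by
    rw [card_filter, sum_product]
    refine sum_congr rfl fun q _ => ?_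
    rw [card_filter]
    exact sum_congr rfl fun p _ => by simp only [eq_comm]
  rw [h3, ← card_product, ← smul_eq_mul, ← sum_const]
  refine sum_le_sum fun q _ => ?_
  calc #{p ∈ B ×ˢ S | κ p = κ q}
      ≤ #(({b ∈ B | rankIn B b / k = rankIn B q.1 / k}) ×ˢ
          ({b ∈ S | rankIn S b / m = rankIn S q.2 / m})) := by
        refine card_le_card fun p hp => ?_
        simp only [hκ, mem_filter, mem_product, Prod.mk.injEq] at hp ⊢
        tauto
    _ ≤ k * m := by
        rw [card_product]
        exact Nat.mul_le_mul (card_rankIn_div_eq_le B hk _) (card_rankIn_div_eq_le S hm _)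

theorem sum_card_pointsOn_le_mul_left (B S : Finset ℝ) {L : Finset (ℝ × ℝ)}
    (hL : ∀ l ∈ L, l.1 ≠ 0) : ∑ l ∈ L, #(pointsOn B S l) ≤ #L * #B := by
  rw [← smul_eq_mul, ← sum_const]
  refine sum_le_sum fun l hl => card_le_card_of_injOn Prod.fst (fun p hp => ?_) ?_
  · exact (mem_product.1 (mem_filter.1 hp).1).1
  · intro p hp p' hp' h
    have e := (mem_filter.1 hp).2
    have e' := (mem_filter.1 hp').2
    rw [h] at e
    exact Prod.ext h (mul_right_cancel₀ (hL l hl) (e.trans e'.symm))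

theorem sum_card_pointsOn_le_mul_right (B S : Finset ℝ) (L : Finset (ℝ × ℝ)) :
    ∑ l ∈ L, #(pointsOn B S l) ≤ #L * #S := by
  rw [← smul_eq_mul, ← sum_const]
  refine sum_le_sum fun l hl => card_le_card_of_injOn Prod.snd (fun p hp => ?_) ?_
  · exact (mem_product.1 (mem_filter.1 hp).1).2
  · intro p hp p' hp' h
    have e := (mem_filter.1 hp).2
    have e' := (mem_filter.1 hp').2
    rw [h] at e
    exact Prod.ext (by linarith) h

/-- The Szemerédi–Trotter bound for Cartesian products: a family of lines with at least four
incidences per line on average satisfies `I³ ≪ |L|² (|B||S|)²`. -/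
theorem sum_card_pointsOn_cube_le (B S : Finset ℝ) {L : Finset (ℝ × ℝ)} (hL : ∀ l ∈ L, l.1 ≠ 0)
    (hI : 4 * #L ≤ ∑ l ∈ L, #(pointsOn B S l)) :
    (∑ l ∈ L, #(pointsOn B S l)) ^ 3 ≤ 324 * (#L ^ 2 * (#B * #S) ^ 2) := by
  set I := ∑ l ∈ L, #(pointsOn B S l) with hIdef
  rcases Nat.eq_zero_or_pos I with h0 | hIpos
  · simp [h0]
  have hIB : I ≤ #L * #B := sum_card_pointsOn_le_mul_left B S hL
  have hIS : I ≤ #L * #S := sum_card_pointsOn_le_mul_right B S L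
  have key : ∀ n : ℕ, I ≤ #L * n → ∃ k : ℕ, 0 < k ∧ #L * (n / k) * 8 ≤ I ∧ k * I ≤ 9 * (#L * n) := by
    intro n hn
    refine ⟨8 * (#L * n) / I + 1, by positivity, ?_, ?_⟩
    · set k := 8 * (#L * n) / I + 1
      have h1 : 8 * (#L * n) < k * I := Nat.lt_mul_of_div_lt (Nat.lt_succ_self _) hIpos
      have h2 : n / k * k ≤ n := Nat.div_mul_le_self n k
      have h3 : #L * (n / k) * 8 * k ≤ I * k := by nlinarith
      exact Nat.le_of_mul_le_mul_right h3 (by positivity)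
    · have := Nat.div_mul_le_self (8 * (#L * n)) I
      nlinarith
  obtain ⟨k, hk, hk1, hk2⟩ := key _ hIB
  obtain ⟨m, hm, hm1, hm2⟩ := key _ hIS
  have main := sum_card_pointsOn_le B S hL hk hm
  rw [← hIdef] at main
  have h1 : I ≤ 2 * (#B * #S * (k * m)) := by nlinarith
  have h2 : (k * I) * (m * I) ≤ (9 * (#L * #B)) * (9 * (#L * #S)) := Nat.mul_le_mul hk2 hm2
  calc I ^ 3 = I * (I * I) := by ring
    _ ≤ 2 * (#B * #S * (k * m)) * (I * I) := Nat.mul_le_mul_right _ h1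
    _ = 2 * (#B * #S) * ((k * I) * (m * I)) := by ring
    _ ≤ 2 * (#B * #S) * ((9 * (#L * #B)) * (9 * (#L * #S))) := Nat.mul_le_mul_left _ h2
    _ ≤ 324 * (#L ^ 2 * (#B * #S) ^ 2) := by nlinarith [Nat.zero_le (#L ^ 2 * (#B * #S) ^ 2)]

open Matrix in
/-- A symmetric matrix with nonnegative entries has a nonnegative unit eigenvector whose
eigenvalue is at least the average row sum. -/
theorem exists_nonneg_unit_eigenvector {ι : Type*} [Fintype ι] [Nonempty ι] {M : Matrix ι ι ℝ}
    (hM : M.IsSymm) (h0 : ∀ x y, 0 ≤ M x y) :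
    ∃ (g : ι → ℝ) (μ : ℝ), (∀ x, 0 ≤ g x) ∧ g ⬝ᵥ g = 1 ∧ M *ᵥ g = μ • g ∧
      ∑ x, ∑ y, M x y ≤ μ * Fintype.card ι := by
  set K : Set (ι → ℝ) := {v | v ⬝ᵥ v = 1} with hK
  have hcomp : IsCompact K := by
    refine Metric.isCompact_of_isClosed_isBounded ?_ ?_
    · exact isClosed_eq (by unfold dotProduct; fun_prop) continuous_const
    · refine (Metric.isBounded_closedBall (x := (0 : ι → ℝ)) (r := 1)).subset fun v hv => ?_
      rw [mem_closedBall_zero_iff, pi_norm_le_iff_of_nonneg zero_le_one]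
      intro i
      have h1 : v i * v i ≤ v ⬝ᵥ v :=
        single_le_sum (f := fun i => v i * v i) (fun j _ => mul_self_nonneg _) (mem_univ i)
      rw [show v ⬝ᵥ v = 1 from hv] at h1
      exact abs_le_one_iff_mul_self_le_one.2 h1
  have hcard : (0 : ℝ) < Fintype.card ι := by exact_mod_cast Fintype.card_pos
  have scale : ∀ v : ι → ℝ, v ≠ 0 → ∃ w ∈ K, ∃ c : ℝ, v = c • w ∧ c * c = v ⬝ᵥ v := by
    intro v hv
    have hpos : 0 < v ⬝ᵥ v :=
      lt_of_le_of_ne (sum_nonneg fun i _ => mul_self_nonneg _)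
        (fun h => hv (dotProduct_self_eq_zero.1 h.symm))
    have hs := Real.mul_self_sqrt hpos.le
    have hs0 : √(v ⬝ᵥ v) ≠ 0 := (Real.sqrt_pos.2 hpos).ne'
    refine ⟨(√(v ⬝ᵥ v))⁻¹ • v, ?_, √(v ⬝ᵥ v), ?_, hs⟩
    · simp only [hK, Set.mem_ofPred_eq, smul_dotProduct, dotProduct_smul, smul_eq_mul]
      rw [← mul_assoc, ← mul_inv, hs, inv_mul_cancel₀ hpos.ne']
    · rw [smul_smul, mul_inv_cancel₀ hs0, one_smul]
  have hne : K.Nonempty := by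
    obtain ⟨w, hw, -⟩ := scale (fun _ => 1) (fun h => by
      have := congrFun h (Classical.arbitrary ι); simp at this)
    exact ⟨w, hw⟩
  have hcont : Continuous fun v : ι → ℝ => v ⬝ᵥ M *ᵥ v := by
    unfold mulVec dotProduct; fun_prop
  obtain ⟨f, hf, hmax⟩ := hcomp.exists_isMaxOn hne hcont.continuousOn
  set μ := f ⬝ᵥ M *ᵥ f with hμ
  set g : ι → ℝ := fun i => |f i| with hg
  have hgg : g ⬝ᵥ g = 1 := by
    rw [← show f ⬝ᵥ f = 1 from hf]
    exact sum_congr rfl fun i _ => abs_mul_abs_self _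
  have hQ : ∀ v : ι → ℝ, v ⬝ᵥ M *ᵥ v ≤ μ * (v ⬝ᵥ v) := by
    intro v
    rcases eq_or_ne v 0 with rfl | hv
    · simp
    obtain ⟨w, hw, c, rfl, hc⟩ := scale v hv
    have := hmax hw
    rw [← hc]
    simp only [mulVec_smul, smul_dotProduct, dotProduct_smul, smul_eq_mul]
    rw [← mul_assoc, mul_comm μ]
    exact mul_le_mul_of_nonneg_left this (mul_self_nonneg c)
  have hgμ : g ⬝ᵥ M *ᵥ g = μ := by
    refine le_antisymm (by simpa [hgg] using hQ g) ?_
    rw [hμ]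
    simp only [dotProduct, mulVec, mul_sum]
    refine sum_le_sum fun i _ => sum_le_sum fun j _ => ?_
    refine (le_abs_self _).trans ?_
    rw [abs_mul, abs_mul, abs_of_nonneg (h0 i j)]
  have hsymm : ∀ u v : ι → ℝ, u ⬝ᵥ M *ᵥ v = v ⬝ᵥ M *ᵥ u := fun u v => by
    rw [dotProduct_mulVec, ← mulVec_transpose, hM.eq, dotProduct_comm]
  have heig : M *ᵥ g = μ • g := by
    have hlin : ∀ h : ι → ℝ, h ⬝ᵥ (μ • g - M *ᵥ g) = 0 := by
      intro h
      set b := h ⬝ᵥ (μ • g - M *ᵥ g) with hb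
      have hquad : ∀ e : ℝ, 0 ≤ (μ * (h ⬝ᵥ h) - h ⬝ᵥ M *ᵥ h) * (e * e) + (2 * b) * e + 0 := by
        intro e
        have := hQ (g + e • h)
        simp only [mulVec_add, mulVec_smul, add_dotProduct, dotProduct_add, smul_dotProduct,
          dotProduct_smul, smul_eq_mul, hgμ, hgg, hsymm g h, dotProduct_comm g h] at this
        simp only [hb, dotProduct_sub, dotProduct_smul, smul_eq_mul]
        nlinarith
      have := discrim_le_zero hquad
      unfold discrim at this
      nlinarith [sq_nonneg b]
    have := dotProduct_self_eq_zero.1 (hlin (μ • g - M *ᵥ g))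
    exact (sub_eq_zero.1 this).symm
  refine ⟨g, μ, fun _ => abs_nonneg _, hgg, heig, ?_⟩
  have := hQ (fun _ => 1)
  simpa [dotProduct, mulVec] using this

open Matrix in
theorem mul_sum_cube_le_trace {ι κ : Type*} [Fintype ι] [Fintype κ] {M : Matrix ι ι ℝ}
    (hM : M.IsSymm) (h0 : ∀ x y, 0 ≤ M x y) (N : Matrix ι κ ℝ) {t : ℝ} (ht : 0 ≤ t)
    (hN : ∀ x y, t * M x y ≤ (N * Nᵀ) x y) :
    t * (∑ x, ∑ y, M x y) ^ 3 ≤ (Fintype.card ι : ℝ) ^ 3 * trace (M * (N * Nᵀ) * M) := by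
  rcases isEmpty_or_nonempty ι with he | hne
  · simp
  obtain ⟨g, μ, hg0, hgg, heig, hμ⟩ := exists_nonneg_unit_eigenvector hM h0
  have hS : 0 ≤ ∑ x, ∑ y, M x y := sum_nonneg fun x _ => sum_nonneg fun y _ => h0 x y
  have hcard : (0 : ℝ) < Fintype.card ι := by exact_mod_cast Fintype.card_pos
  have hμ0 : 0 ≤ μ := nonneg_of_mul_nonneg_left (hS.trans hμ) hcard
  have hquad : t * μ ≤ g ⬝ᵥ (N * Nᵀ) *ᵥ g := by
    have : t * (g ⬝ᵥ M *ᵥ g) ≤ g ⬝ᵥ (N * Nᵀ) *ᵥ g := by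
      simp only [dotProduct, mulVec, mul_sum]
      refine sum_le_sum fun x _ => sum_le_sum fun y _ => ?_
      nlinarith [mul_le_mul_of_nonneg_left (hN x y) (mul_nonneg (hg0 x) (hg0 y))]
    simpa [heig, hgg] using this
  have htrace : trace (M * (N * Nᵀ) * M) = ∑ k, ∑ x, (Nᵀ * M) k x ^ 2 := by
    have : M * (N * Nᵀ) * M = (Nᵀ * M)ᵀ * (Nᵀ * M) := by
      rw [transpose_mul, transpose_transpose, hM.eq]; simp only [Matrix.mul_assoc]
    rw [this, trace, sum_comm]
    refine sum_congr rfl fun x _ => ?_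
    rw [diag_apply, Matrix.mul_apply]
    exact sum_congr rfl fun k _ => by rw [transpose_apply, sq]
  have hCS : (Nᵀ * M) *ᵥ g ⬝ᵥ (Nᵀ * M) *ᵥ g ≤ trace (M * (N * Nᵀ) * M) := by
    rw [htrace]
    refine sum_le_sum fun k _ => ?_
    have := sum_mul_sq_le_sq_mul_sq univ (fun x => (Nᵀ * M) k x) g
    have h1 : ∑ x, g x ^ 2 = 1 := by rw [← hgg]; exact sum_congr rfl fun _ _ => sq _
    rw [h1, mul_one] at this
    rw [← sq]; exact this
  have hexp : (Nᵀ * M) *ᵥ g ⬝ᵥ (Nᵀ * M) *ᵥ g = μ ^ 2 * (g ⬝ᵥ (N * Nᵀ) *ᵥ g) := by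
    rw [← mulVec_mulVec, heig, mulVec_smul, smul_dotProduct, dotProduct_smul, ← mulVec_mulVec,
      dotProduct_mulVec g N, ← mulVec_transpose, smul_eq_mul, smul_eq_mul]
    ring
  calc t * (∑ x, ∑ y, M x y) ^ 3 ≤ t * (μ * Fintype.card ι) ^ 3 := by gcongr
    _ = (Fintype.card ι : ℝ) ^ 3 * (μ ^ 2 * (t * μ)) := by ring
    _ ≤ _ := by
      gcongr
      refine le_trans ?_ hCS
      rw [hexp]
      gcongr

section FiberMoments

variable {ι κ β : Type*} [DecidableEq β]

/-- The size of the fiber of `f` over `y` inside `s`. -/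
def fib (s : Finset ι) (f : ι → β) (y : β) : ℕ := #{i ∈ s | f i = y}

/-- The `k`-th moment of the fiber sizes of `f` on `s`. -/
def fiberMoment (k : ℕ) (s : Finset ι) (f : ι → β) : ℕ := ∑ y ∈ s.image f, fib s f y ^ k

/-- The values whose fiber has size in the dyadic range `[2 ^ i, 2 ^ (i + 1))`. -/
def fiberLevel (s : Finset ι) (f : ι → β) (i : ℕ) : Finset β :=
  {y ∈ s.image f | Nat.log 2 (fib s f y) = i}

theorem fib_pos_iff {s : Finset ι} {f : ι → β} {y : β} : 0 < fib s f y ↔ y ∈ s.image f := by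
  simp [fib, card_pos, Finset.Nonempty]

theorem sum_fib_pow_le {k : ℕ} (hk : k ≠ 0) (s : Finset ι) (f : ι → β) (T : Finset β) :
    ∑ y ∈ T, fib s f y ^ k ≤ fiberMoment k s f := by
  have h : ∑ y ∈ T with y ∈ s.image f, fib s f y ^ k = ∑ y ∈ T, fib s f y ^ k := by
    refine sum_filter_of_ne fun y _ hy => fib_pos_iff.1 (Nat.pos_of_ne_zero fun h0 => hy ?_)
    rw [h0, zero_pow hk]
  rw [← h]
  exact sum_le_sum_of_subset fun y hy => (mem_filter.1 hy).2

theorem pow_mul_card_le_fiberMoment {k : ℕ} (hk : k ≠ 0) {s : Finset ι} {f : ι → β}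
    {T : Finset β} {m : ℕ} (h : ∀ y ∈ T, m ≤ fib s f y) : m ^ k * #T ≤ fiberMoment k s f := by
  refine le_trans ?_ (sum_fib_pow_le hk s f T)
  rw [mul_comm, ← smul_eq_mul, ← sum_const]
  exact sum_le_sum fun y hy => Nat.pow_le_pow_left (h y hy) k

theorem fiberMoment_one (s : Finset ι) (f : ι → β) : fiberMoment 1 s f = #s := by
  simp only [fiberMoment, pow_one]
  exact (card_eq_sum_card_image f s).symm

theorem mem_fiberLevel {s : Finset ι} {f : ι → β} {i : ℕ} {y : β} :
    y ∈ fiberLevel s f i ↔ 2 ^ i ≤ fib s f y ∧ fib s f y < 2 ^ (i + 1) := by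
  rw [fiberLevel, mem_filter, ← fib_pos_iff]
  constructor
  · rintro ⟨h0, rfl⟩
    exact ⟨Nat.pow_log_le_self 2 h0.ne', Nat.lt_pow_succ_log_self one_lt_two _⟩
  · rintro ⟨h1, h2⟩
    exact ⟨lt_of_lt_of_le (by positivity) h1, Nat.log_eq_of_pow_le_of_lt_pow h1 h2⟩

theorem exists_le_mul_of_le_sum {J m : ℕ} (hJ : 0 < J) {x : ℕ → ℕ} (h : m ≤ ∑ i ∈ range J, x i) :
    ∃ i < J, m ≤ J * x i := by
  obtain ⟨i, hi, hmax⟩ := (range J).exists_max_image x ⟨0, mem_range.2 hJ⟩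
  refine ⟨i, mem_range.1 hi, h.trans ?_⟩
  simpa using sum_le_card_nsmul (range J) x (x i) hmax

/-- Dyadic pigeonholing of a sum of powers of fiber sizes along a map `g`. -/
theorem exists_sum_fib_comp_pow_le {J k : ℕ} (hJ : 0 < J) (hk : k ≠ 0) {s : Finset ι} {f : ι → β}
    (hs : ∀ y, fib s f y < 2 ^ J) (T : Finset κ) (g : κ → β) :
    ∃ i < J, ∑ z ∈ T, fib s f (g z) ^ k ≤
      J * ((2 ^ (i + 1)) ^ k * #{z ∈ T | g z ∈ fiberLevel s f i}) := by
  refine exists_le_mul_of_le_sum hJ ?_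
  have h : ∀ i, (2 ^ (i + 1)) ^ k * #{z ∈ T | g z ∈ fiberLevel s f i} =
      ∑ z ∈ T, if g z ∈ fiberLevel s f i then (2 ^ (i + 1)) ^ k else 0 := fun i => by
    rw [← sum_filter, sum_const, smul_eq_mul, mul_comm]
  simp_rw [h]
  rw [sum_comm]
  refine sum_le_sum fun z _ => ?_
  rcases Nat.eq_zero_or_pos (fib s f (g z)) with h0 | h0
  · rw [h0, zero_pow hk]; exact Nat.zero_le _
  · have hlog : Nat.log 2 (fib s f (g z)) ∈ range J :=
      mem_range.2 (Nat.log_lt_of_lt_pow h0.ne' (hs _))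
    have hmem : g z ∈ fiberLevel s f (Nat.log 2 (fib s f (g z))) :=
      mem_filter.2 ⟨fib_pos_iff.1 h0, rfl⟩
    refine le_trans ?_ (single_le_sum (f := fun i =>
      if g z ∈ fiberLevel s f i then (2 ^ (i + 1)) ^ k else 0) (fun _ _ => Nat.zero_le _) hlog)
    simp only [hmem, if_true]
    exact Nat.pow_le_pow_left (mem_fiberLevel.1 hmem).2.le k

theorem exists_fiberMoment_le_level {J k : ℕ} (hJ : 0 < J) (hk : k ≠ 0) {s : Finset ι} {f : ι → β}
    (hs : ∀ y, fib s f y < 2 ^ J) :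
    ∃ i < J, fiberMoment k s f ≤ J * ((2 ^ (i + 1)) ^ k * #(fiberLevel s f i)) := by
  obtain ⟨i, hi, h⟩ := exists_sum_fib_comp_pow_le hJ hk hs (s.image f) id
  refine ⟨i, hi, h.trans ?_⟩
  gcongr
  exact fun y hy => (mem_filter.1 hy).2

theorem fiberMoment_two_sq_le (s : Finset ι) (f : ι → β) :
    fiberMoment 2 s f ^ 2 ≤ #s * fiberMoment 3 s f := by
  rw [← fiberMoment_one s f]
  refine sum_sq_le_sum_mul_sum_of_sq_le_mul _ (fun _ _ => Nat.zero_le _) (fun _ _ => Nat.zero_le _)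
    fun y _ => le_of_eq (by ring)

theorem card_filter_eq_sum_fib_mul_fib (s : Finset ι) (f : ι → β) (s' : Finset κ) (g : κ → β) :
    #{p ∈ s ×ˢ s' | f p.1 = g p.2} = ∑ y ∈ s.image f, fib s f y * fib s' g y := by
  rw [card_eq_sum_card_fiberwise (f := fun p => f p.1) (t := s.image f)]
  · refine sum_congr rfl fun y _ => ?_
    rw [fib, fib, ← card_product]
    congr 1
    ext p
    simp only [mem_filter, mem_product]
    constructor
    · rintro ⟨⟨⟨h1, h2⟩, h3⟩, h4⟩
      exact ⟨⟨h1, h4⟩, h2, h3.symm.trans h4⟩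
    · rintro ⟨⟨h1, h4⟩, h2, h3⟩
      exact ⟨⟨⟨h1, h2⟩, h4.trans h3.symm⟩, h4⟩
  · intro p hp
    exact mem_coe.2 (mem_image_of_mem f (mem_product.1 (mem_filter.1 hp).1).1)

theorem card_filter_eq_fiberMoment_two (s : Finset ι) (f : ι → β) :
    #{p ∈ s ×ˢ s | f p.1 = f p.2} = fiberMoment 2 s f := by
  rw [card_filter_eq_sum_fib_mul_fib]
  exact sum_congr rfl fun _ _ => (sq _).symm

theorem card_filter_eq_sq_le (s : Finset ι) (f : ι → β) (s' : Finset κ) (g : κ → β) :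
    #{p ∈ s ×ˢ s' | f p.1 = g p.2} ^ 2 ≤ fiberMoment 2 s f * fiberMoment 2 s' g := by
  rw [card_filter_eq_sum_fib_mul_fib]
  refine (sum_mul_sq_le_sq_mul_sq _ _ _).trans ?_
  exact Nat.mul_le_mul le_rfl (sum_fib_pow_le two_ne_zero _ _ _)

end FiberMoments

section Group

variable {G : Type*} [AddCommGroup G] [DecidableEq G]

/-- The difference of a pair. -/
def subPair (p : G × G) : G := p.1 - p.2

theorem fib_subPair_neg (A : Finset G) (x : G) :
    fib (A ×ˢ A) subPair (-x) = fib (A ×ˢ A) subPair x := by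
  have h : ∀ y, ∀ p ∈ ({p ∈ A ×ˢ A | subPair p = y} : Finset (G × G)),
      p.swap ∈ ({p ∈ A ×ˢ A | subPair p = -y} : Finset (G × G)) := fun y p hp => by
    obtain ⟨hp, e⟩ := mem_filter.1 hp
    obtain ⟨h1, h2⟩ := mem_product.1 hp
    exact mem_filter.2 ⟨mem_product.2 ⟨h2, h1⟩, by rw [← e]; exact (neg_sub _ _).symm⟩
  refine card_bij' (fun p _ => p.swap) (fun p _ => p.swap) (fun p hp => ?_) (h x) ?_ ?_
  · simpa using h (-x) p hp
  · simp
  · simp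

theorem fib_subPair_le (A B : Finset G) (x : G) : fib (A ×ˢ B) subPair x ≤ #A := by
  refine card_le_card_of_injOn Prod.fst (fun p hp => ?_) ?_
  · exact (mem_product.1 (mem_filter.1 hp).1).1
  · intro p hp q hq h
    have e1 := (mem_filter.1 hp).2
    have e2 := (mem_filter.1 hq).2
    unfold subPair at e1 e2
    refine Prod.ext h ?_
    rw [← e2, h] at e1
    exact sub_right_injective e1

/-- For a triple `(x, y, z)`, the pair of differences `(x - y, z - x)`. -/
def subTriple (q : G × G × G) : G × G := (q.1 - q.2.1, q.2.2 - q.1)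

theorem fiberMoment_two_subTriple_le (A : Finset G) :
    fiberMoment 2 (A ×ˢ A ×ˢ A) subTriple ≤ fiberMoment 3 (A ×ˢ A) subPair := by
  have h3 : fiberMoment 3 (A ×ˢ A) subPair =
      #(((A ×ˢ A).image subPair).sigma fun u =>
        ({p ∈ A ×ˢ A | subPair p = u} ×ˢ {p ∈ A ×ˢ A | subPair p = u} ×ˢ
          {p ∈ A ×ˢ A | subPair p = u})) := by
    rw [card_sigma]
    refine sum_congr rfl fun u _ => ?_
    rw [card_product, card_product, fib]
    ring
  rw [← card_filter_eq_fiberMoment_two, h3]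
  refine card_le_card_of_injOn (fun p => ⟨p.1.1 - p.2.1,
    (p.1.1, p.2.1), (p.1.2.1, p.2.2.1), (p.1.2.2, p.2.2.2)⟩) ?_ ?_
  · rintro ⟨⟨x, y, z⟩, x', y', z'⟩ hp
    simp only [coe_filter, mem_product, subTriple, Prod.mk.injEq, Set.mem_ofPred_eq] at hp
    obtain ⟨⟨⟨hx, hy, hz⟩, hx', hy', hz'⟩, h1, h2⟩ := hp
    simp only [coe_sigma, Set.mem_sigma_iff, mem_coe, mem_image, mem_product, mem_filter]
    have e1 : y - y' = x - x' := by
      rw [sub_eq_sub_iff_add_eq_add] at h1 ⊢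
      rw [add_comm y, h1, add_comm]
    have e2 : z - z' = x - x' := by
      rw [sub_eq_sub_iff_add_eq_add] at h2 ⊢
      rw [h2, add_comm]
    exact ⟨⟨(x, x'), ⟨hx, hx'⟩, rfl⟩, ⟨⟨hx, hx'⟩, rfl⟩, ⟨⟨hy, hy'⟩, e1⟩, ⟨hz, hz'⟩, e2⟩
  · rintro ⟨⟨x, y, z⟩, x', y', z'⟩ - ⟨⟨a, b, c⟩, a', b', c'⟩ - h
    simp only [Sigma.mk.injEq, heq_eq_eq, Prod.mk.injEq] at h
    obtain ⟨-, ⟨rfl, rfl⟩, ⟨rfl, rfl⟩, rfl, rfl⟩ := h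
    rfl

theorem addEnergy_le_fiberMoment_two (A : Finset G) :
    _root_.addEnergy A ≤ fiberMoment 2 (A ×ˢ A) subPair := by
  rw [← card_filter_eq_fiberMoment_two, _root_.addEnergy]
  refine card_le_card_of_injOn (fun q => ((q.1, q.2.2.1), (q.2.2.2, q.2.1))) ?_ ?_
  · rintro ⟨a, b, c, d⟩ hp
    simp only [coe_filter, mem_product, Set.mem_ofPred_eq] at hp ⊢
    obtain ⟨⟨ha, hb, hc, hd⟩, h⟩ := hp
    exact ⟨⟨⟨ha, hc⟩, hd, hb⟩, by rw [subPair, subPair, sub_eq_sub_iff_add_eq_add, h, add_comm]⟩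
  · rintro ⟨a, b, c, d⟩ - ⟨a', b', c', d'⟩ - h
    simp only [Prod.mk.injEq] at h ⊢
    tauto

theorem fiberLevel_neg_mem {A : Finset G} {i : ℕ} {x : G}
    (h : x ∈ fiberLevel (A ×ˢ A) subPair i) : -x ∈ fiberLevel (A ×ˢ A) subPair i := by
  rw [mem_fiberLevel] at h ⊢
  rwa [fib_subPair_neg]

/-- Counting triples `(x, y, z) ∈ A³` with `x - y, z - x ∈ P` weighted by the number of
representations of `z - y`, where `P` is a dyadic level set of popular differences of `A`. -/
theorem mul_card_level_cube_le (A : Finset G) (i : ℕ) :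
    2 ^ i * (2 ^ i * #(fiberLevel (A ×ˢ A) subPair i)) ^ 3 ≤
      #A ^ 3 * ∑ q ∈ fiberLevel (A ×ˢ A) subPair i ×ˢ fiberLevel (A ×ˢ A) subPair i,
        fib (A ×ˢ A ×ˢ A) subTriple q * fib (A ×ˢ A) subPair (q.1 + q.2) := by
  set P := fiberLevel (A ×ˢ A) subPair i with hP
  set r := fib (A ×ˢ A) (subPair (G := G)) with hr
  set U := (A ×ˢ A).image subPair with hU
  set M : Matrix A A ℝ := Matrix.of fun x y => if (x : G) - y ∈ P then 1 else 0
  set N : Matrix A U ℝ := Matrix.of fun x u => if (x : G) - u ∈ A then 1 else 0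
  have hMa : ∀ x y : A, M x y = if (x : G) - y ∈ P then 1 else 0 := fun _ _ => rfl
  have hNa : ∀ (x : A) (u : U), N x u = if (x : G) - u ∈ A then 1 else 0 := fun _ _ => rfl
  have hM : M.IsSymm := by
    ext x y
    rw [Matrix.transpose_apply, hMa, hMa]
    refine if_congr ⟨fun h => ?_, fun h => ?_⟩ rfl rfl
    · rw [← neg_sub]; exact fiberLevel_neg_mem h
    · rw [← neg_sub]; exact fiberLevel_neg_mem h
  have h0 : ∀ x y, 0 ≤ M x y := fun x y => by rw [hMa]; split_ifs <;> simp
  have hNN : ∀ x y : A, (N * N.transpose) x y = r (x - y) := by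
    intro x y
    simp only [Matrix.mul_apply, Matrix.transpose_apply, hNa, mul_ite, mul_one, mul_zero]
    rw [sum_coe_sort U (fun u => if (y : G) - u ∈ A then if (x : G) - u ∈ A then (1 : ℝ) else 0
      else 0)]
    simp only [← ite_and]
    rw [← natCast_card_filter]
    norm_cast
    refine card_bij' (fun u _ => ((x : G) - u, (y : G) - u)) (fun p _ => x - p.1) ?_ ?_ ?_ ?_
    · intro u hu
      obtain ⟨-, h1, h2⟩ := mem_filter.1 hu
      simp only [mem_filter, mem_product]
      exact ⟨⟨h2, h1⟩, sub_sub_sub_cancel_right _ _ _⟩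
    · rintro ⟨a, b⟩ hp
      simp only [mem_filter, mem_product] at hp
      obtain ⟨⟨ha, hb⟩, hab⟩ := hp
      simp only [subPair] at hab
      have e : (y : G) - (x - a) = b := by
        rw [sub_eq_sub_iff_add_eq_add] at hab
        rw [sub_sub_eq_add_sub, sub_eq_iff_eq_add, add_comm (y : G), hab, add_comm]
      simp only [mem_filter, sub_sub_cancel, e]
      exact ⟨mem_image.2 ⟨(↑x, a), mem_product.2 ⟨x.2, ha⟩, rfl⟩, hb, ha⟩
    · intro u _
      simp
    · rintro ⟨a, b⟩ hp
      simp only [mem_filter, mem_product] at hp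
      obtain ⟨⟨ha, hb⟩, hab⟩ := hp
      simp only [subPair] at hab
      have e : (y : G) - (x - a) = b := by
        rw [sub_eq_sub_iff_add_eq_add] at hab
        rw [sub_sub_eq_add_sub, sub_eq_iff_eq_add, add_comm (y : G), hab, add_comm]
      simp [e]
  have hN : ∀ x y, (2 : ℝ) ^ i * M x y ≤ (N * N.transpose) x y := by
    intro x y
    rw [hNN]
    rw [hMa]
    split_ifs with h
    · rw [mul_one]; exact_mod_cast (mem_fiberLevel.1 h).1
    · simp
  have hsum : (2 : ℝ) ^ i * #P ≤ ∑ x, ∑ y, M x y := by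
    have h1 : ∑ x, ∑ y, M x y = #{p ∈ A ×ˢ A | subPair p ∈ P} := by
      rw [natCast_card_filter, sum_product]
      simp only [hMa]
      rw [← sum_coe_sort A]
      refine sum_congr rfl fun x _ => ?_
      rw [← sum_coe_sort A]
      rfl
    have h2 : #{p ∈ A ×ˢ A | subPair p ∈ P} = ∑ x ∈ P, r x := by
      rw [card_eq_sum_card_fiberwise (f := subPair) (t := P)]
      · refine sum_congr rfl fun x hx => ?_
        rw [hr, fib, filter_filter]
        congr 1
        ext p
        simp only [mem_filter]
        constructor
        · rintro ⟨h1, -, h2⟩; exact ⟨h1, h2⟩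
        · rintro ⟨h1, h2⟩; exact ⟨h1, h2 ▸ hx, h2⟩
      · intro p hp
        exact (mem_filter.1 hp).2
    rw [h1, h2]
    have h3 : #P * 2 ^ i ≤ ∑ x ∈ P, r x := by
      rw [← smul_eq_mul, ← sum_const]
      exact sum_le_sum fun x hx => (mem_fiberLevel.1 hx).1
    rw [mul_comm]
    exact_mod_cast h3
  have htrace : Matrix.trace (M * (N * N.transpose) * M) =
      ∑ q ∈ P ×ˢ P, (fib (A ×ˢ A ×ˢ A) subTriple q : ℝ) * r (q.1 + q.2) := by
    have h1 : Matrix.trace (M * (N * N.transpose) * M) =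
        ∑ x ∈ A, ∑ y ∈ A, ∑ z ∈ A,
          if x - y ∈ P ∧ z - x ∈ P then (r (z - y) : ℝ) else 0 := by
      rw [← sum_coe_sort A]
      refine sum_congr rfl fun x _ => ?_
      rw [Matrix.diag_apply, Matrix.mul_apply]
      simp only [Matrix.mul_apply (M := M), sum_mul]
      rw [sum_comm, ← sum_coe_sort A]
      refine sum_congr rfl fun y _ => ?_
      rw [← sum_coe_sort A]
      refine sum_congr rfl fun z _ => ?_
      rw [hNN, ← neg_sub (z : G) y, hr, fib_subPair_neg]
      simp only [hMa, ite_and]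
      split_ifs <;> simp
    have h2 : ∑ q ∈ P ×ˢ P, (fib (A ×ˢ A ×ˢ A) subTriple q : ℝ) * r (q.1 + q.2) =
        ∑ τ ∈ A ×ˢ A ×ˢ A with subTriple τ ∈ P ×ˢ P, (r (τ.2.2 - τ.2.1) : ℝ) := by
      rw [← sum_fiberwise_of_maps_to (g := subTriple) (t := P ×ˢ P)]
      · refine sum_congr rfl fun q hq => ?_
        rw [filter_filter, fib, ← nsmul_eq_mul, ← sum_const]
        refine sum_congr ?_ fun τ hτ => ?_
        · ext τ
          simp only [mem_filter]
          constructor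
          · rintro ⟨h1, h2⟩; exact ⟨h1, h2 ▸ hq, h2⟩
          · rintro ⟨h1, -, h2⟩; exact ⟨h1, h2⟩
        · have := (mem_filter.1 hτ).2
          rw [← this.2]
          simp only [subTriple]
          congr 2
          abel
      · intro τ hτ
        exact (mem_filter.1 hτ).2
    rw [h1, h2, sum_filter, sum_product]
    refine sum_congr rfl fun x _ => ?_
    rw [sum_product]
    simp only [subTriple, mem_product]
  have main := mul_sum_cube_le_trace hM h0 N (t := 2 ^ i) (by positivity) hN
  rw [htrace, Fintype.card_coe] at main
  have : (2 : ℝ) ^ i * (2 ^ i * #P) ^ 3 ≤ 2 ^ i * (∑ x, ∑ y, M x y) ^ 3 := by gcongr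
  exact_mod_cast this.trans main

/-- The number of pairs of a level set with sum in a level set, bounded by energies. -/
theorem mul_card_add_mem_sq_le (A P D : Finset G) {m : ℕ}
    (hP : ∀ x ∈ P, m ≤ fib (A ×ˢ A) subPair x) :
    (m * #{q ∈ P ×ˢ P | q.1 + q.2 ∈ D}) ^ 2 ≤
      fiberMoment 2 (A ×ˢ D) subPair * fiberMoment 2 (A ×ˢ P) subPair := by
  refine le_trans (Nat.pow_le_pow_left ?_ 2) (card_filter_eq_sq_le _ _ _ _)
  calc m * #{q ∈ P ×ˢ P | q.1 + q.2 ∈ D}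
      ≤ ∑ q ∈ P ×ˢ P with q.1 + q.2 ∈ D, fib (A ×ˢ A) subPair q.1 := by
        rw [mul_comm, ← smul_eq_mul, ← sum_const]
        exact sum_le_sum fun q hq => hP _ (mem_product.1 (mem_filter.1 hq).1).1
    _ = #(({q ∈ P ×ˢ P | q.1 + q.2 ∈ D}).sigma
          fun q => {p ∈ A ×ˢ A | subPair p = q.1}) := by rw [card_sigma]; rfl
    _ ≤ _ := by
      refine card_le_card_of_injOn
        (fun w => ((w.2.1, w.1.1 + w.1.2), (w.2.2, w.1.2))) ?_ ?_
      · rintro ⟨⟨α, β⟩, a, b⟩ hw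
        simp only [coe_sigma, Set.mem_sigma_iff, mem_coe, mem_filter, mem_product] at hw ⊢
        obtain ⟨⟨⟨hα, hβ⟩, hD⟩, ⟨ha, hb⟩, hab⟩ := hw
        refine ⟨⟨⟨ha, hD⟩, hb, hβ⟩, ?_⟩
        simp only [subPair] at hab ⊢
        rw [← hab]; abel
      · rintro ⟨⟨α, β⟩, a, b⟩ - ⟨⟨α', β'⟩, a', b'⟩ - h
        simp only [Prod.mk.injEq] at h
        obtain ⟨⟨rfl, h1⟩, rfl, rfl⟩ := h
        obtain rfl := add_right_cancel h1
        rfl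

end Group

set_option maxRecDepth 4000 in
theorem energy_pow_le_of_bounds {n E t p Λ K T X y : ℝ} (hE : 0 ≤ E) (ht : 0 < t)
    (hp : 0 ≤ p) (hΛ : 0 ≤ Λ) (hK : 0 ≤ K) (h1 : E ≤ 4 * Λ * (t ^ 2 * p))
    (h2 : t ^ 3 * p ≤ K * n ^ 2) (h3 : t ^ 2 * p ≤ E) (h4 : t * (t * p) ^ 3 ≤ n ^ 3 * T)
    (h5 : T ^ 2 ≤ K * n ^ 2 * X) (h6 : X ≤ 4 * Λ * y)
    (h7 : (t * y) ^ 4 ≤ n ^ 6 * K ^ 4 * E * p ^ 3) :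
    E ^ 26 ≤ 2 ^ 68 * Λ ^ 34 * n ^ 50 * K ^ 14 := by
  rcases hE.eq_or_lt with rfl | hE0
  · rw [zero_pow (by norm_num)]; positivity
  have hy : 0 ≤ Λ * (K * n ^ 2 * y) := by
    have : 0 ≤ K * n ^ 2 * (4 * Λ * y) := by
      have := mul_le_mul_of_nonneg_left h6 (show 0 ≤ K * n ^ 2 by positivity)
      nlinarith [sq_nonneg T]
    nlinarith
  have a1 : t * E ≤ 4 * Λ * (K * n ^ 2) := by
    calc t * E ≤ t * (4 * Λ * (t ^ 2 * p)) := by gcongr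
      _ = 4 * Λ * (t ^ 3 * p) := by ring
      _ ≤ _ := by gcongr
  have a2 : E ^ 3 ≤ 64 * Λ ^ 3 * t ^ 2 * n ^ 3 * T := by
    calc E ^ 3 ≤ (4 * Λ * (t ^ 2 * p)) ^ 3 := by gcongr
      _ = 64 * Λ ^ 3 * t ^ 2 * (t * (t * p) ^ 3) := by ring
      _ ≤ 64 * Λ ^ 3 * t ^ 2 * (n ^ 3 * T) := by gcongr
      _ = _ := by ring
  have a3 : E ^ 6 ≤ 2 ^ 14 * Λ ^ 7 * t ^ 4 * n ^ 8 * K * y := by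
    calc E ^ 6 = (E ^ 3) ^ 2 := by ring
      _ ≤ (64 * Λ ^ 3 * t ^ 2 * n ^ 3 * T) ^ 2 := by gcongr
      _ = 2 ^ 12 * Λ ^ 6 * t ^ 4 * n ^ 6 * T ^ 2 := by ring
      _ ≤ 2 ^ 12 * Λ ^ 6 * t ^ 4 * n ^ 6 * (K * n ^ 2 * (4 * Λ * y)) := by
        gcongr
        exact h5.trans (by gcongr)
      _ = _ := by ring
  have a4 : E ^ 24 ≤ 2 ^ 56 * Λ ^ 28 * t ^ 6 * n ^ 38 * K ^ 8 * E ^ 4 := by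
    calc E ^ 24 = (E ^ 6) ^ 4 := by ring
      _ ≤ (2 ^ 14 * Λ ^ 7 * t ^ 4 * n ^ 8 * K * y) ^ 4 := by gcongr
      _ = 2 ^ 56 * Λ ^ 28 * t ^ 12 * n ^ 32 * K ^ 4 * (t * y) ^ 4 := by ring
      _ ≤ 2 ^ 56 * Λ ^ 28 * t ^ 12 * n ^ 32 * K ^ 4 * (n ^ 6 * K ^ 4 * E * p ^ 3) := by gcongr
      _ = 2 ^ 56 * Λ ^ 28 * t ^ 6 * n ^ 38 * K ^ 8 * E * (t ^ 2 * p) ^ 3 := by ring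
      _ ≤ 2 ^ 56 * Λ ^ 28 * t ^ 6 * n ^ 38 * K ^ 8 * E * E ^ 3 := by gcongr
      _ = _ := by ring
  refine le_of_mul_le_mul_right ?_ (pow_pos hE0 4)
  calc E ^ 26 * E ^ 4 = E ^ 24 * E ^ 6 := by ring
    _ ≤ 2 ^ 56 * Λ ^ 28 * t ^ 6 * n ^ 38 * K ^ 8 * E ^ 4 * E ^ 6 := by gcongr
    _ = 2 ^ 56 * Λ ^ 28 * n ^ 38 * K ^ 8 * E ^ 4 * (t * E) ^ 6 := by ring
    _ ≤ 2 ^ 56 * Λ ^ 28 * n ^ 38 * K ^ 8 * E ^ 4 * (4 * Λ * (K * n ^ 2)) ^ 6 :=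
      mul_le_mul_of_nonneg_left (pow_le_pow_left₀ (by positivity) a1 6) (by positivity)
    _ = _ := by ring

/-- If the third moment of the representation function of `A - B` is at most `K |B|²` for all `B`,
then, up to logarithms, the energy of `A` is at most `K ^ (7 / 13) * |A| ^ (25 / 13)`. -/
theorem fiberMoment_two_pow_le {G : Type*} [AddCommGroup G] [DecidableEq G] {A : Finset G} {J : ℕ}
    (hJ : 0 < J) (hAJ : #A < 2 ^ J) {K : ℝ} (hK : 0 ≤ K)
    (H : ∀ B : Finset G, (fiberMoment 3 (A ×ˢ B) subPair : ℝ) ≤ K * (#B : ℝ) ^ 2) :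
    (fiberMoment 2 (A ×ˢ A) subPair : ℝ) ^ 26 ≤
      2 ^ 68 * (J : ℝ) ^ 34 * (#A : ℝ) ^ 50 * K ^ 14 := by
  have hfib : ∀ y, fib (A ×ˢ A) subPair y < 2 ^ J := fun y => (fib_subPair_le A A y).trans_lt hAJ
  have hE : ∀ B : Finset G, (fiberMoment 2 (A ×ˢ B) subPair : ℝ) ^ 2 ≤ #A * K * (#B : ℝ) ^ 3 := by
    intro B
    have h : (fiberMoment 2 (A ×ˢ B) subPair : ℝ) ^ 2 ≤
        (#A * #B) * fiberMoment 3 (A ×ˢ B) subPair := by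
      exact_mod_cast (card_product A B) ▸ fiberMoment_two_sq_le (A ×ˢ B) subPair
    calc _ ≤ _ := h
      _ ≤ (#A * #B) * (K * (#B : ℝ) ^ 2) := by gcongr; exact H B
      _ = _ := by ring
  obtain ⟨i, -, hi⟩ := exists_fiberMoment_le_level hJ two_ne_zero hfib
  have hlev : ∀ k ≠ 0, ∀ j, ((2 : ℝ) ^ j) ^ k * #(fiberLevel (A ×ˢ A) subPair j) ≤
      fiberMoment k (A ×ˢ A) subPair := fun k hk j => by
    exact_mod_cast pow_mul_card_le_fiberMoment hk fun y hy => (mem_fiberLevel.1 hy).1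
  set P := fiberLevel (A ×ˢ A) subPair i with hP
  obtain ⟨j, -, hj⟩ := exists_sum_fib_comp_pow_le hJ two_ne_zero hfib (P ×ˢ P)
    (fun q => q.1 + q.2)
  set D := fiberLevel (A ×ˢ A) subPair j with hD
  set N := #{q ∈ P ×ˢ P | q.1 + q.2 ∈ D} with hN
  set X := ∑ q ∈ P ×ˢ P, fib (A ×ˢ A) subPair (q.1 + q.2) ^ 2 with hX
  set T := ∑ q ∈ P ×ˢ P, fib (A ×ˢ A ×ˢ A) subTriple q * fib (A ×ˢ A) subPair (q.1 + q.2)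
    with hT
  have hcube : (2 : ℝ) ^ i * (2 ^ i * #P) ^ 3 ≤ (#A : ℝ) ^ 3 * T := by
    exact_mod_cast mul_card_level_cube_le A i
  have hTX : (T : ℝ) ^ 2 ≤ fiberMoment 3 (A ×ˢ A) subPair * X := by
    have h : T ^ 2 ≤ fiberMoment 3 (A ×ˢ A) subPair * X := by
      refine (sum_mul_sq_le_sq_mul_sq _ _ _).trans (Nat.mul_le_mul_right _ ?_)
      exact (sum_fib_pow_le two_ne_zero _ _ _).trans (fiberMoment_two_subTriple_le A)
    exact_mod_cast h
  have hNle : ((2 : ℝ) ^ i * N) ^ 2 ≤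
      fiberMoment 2 (A ×ˢ D) subPair * fiberMoment 2 (A ×ˢ P) subPair := by
    exact_mod_cast mul_card_add_mem_sq_le A P D fun x hx => (mem_fiberLevel.1 hx).1
  refine energy_pow_le_of_bounds (t := 2 ^ i) (p := #P) (T := T) (X := X) (y := (2 ^ j) ^ 2 * N)
    (by positivity) (by positivity) (by positivity) (by positivity) hK ?_ ((hlev 3 three_ne_zero i).trans (H A)) (hlev 2 two_ne_zero i) hcube
    (hTX.trans (by gcongr; exact H A)) ?_ ?_
  · have h : (fiberMoment 2 (A ×ˢ A) subPair : ℝ) ≤ J * ((2 ^ (i + 1)) ^ 2 * #P) := by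
      exact_mod_cast hi
    refine h.trans_eq ?_
    ring
  · have h : (X : ℝ) ≤ J * ((2 ^ (j + 1)) ^ 2 * N) := by
      exact_mod_cast hj
    refine h.trans_eq ?_
    ring
  · have h2 := hlev 2 two_ne_zero j
    have h3 := (hlev 3 three_ne_zero j).trans (H A)
    have h4 : ((2 : ℝ) ^ i * N) ^ 4 ≤ (#A * K * (#D : ℝ) ^ 3) * (#A * K * (#P : ℝ) ^ 3) := by
      calc ((2 : ℝ) ^ i * N) ^ 4 = (((2 : ℝ) ^ i * N) ^ 2) ^ 2 := by ring
        _ ≤ (fiberMoment 2 (A ×ˢ D) subPair * fiberMoment 2 (A ×ˢ P) subPair : ℝ) ^ 2 := by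
          gcongr
        _ = (fiberMoment 2 (A ×ˢ D) subPair : ℝ) ^ 2 * (fiberMoment 2 (A ×ˢ P) subPair : ℝ) ^ 2 :=
          by ring
        _ ≤ _ := mul_le_mul (hE D) (hE P) (by positivity) (by positivity)
    calc ((2 : ℝ) ^ i * ((2 ^ j) ^ 2 * N)) ^ 4 = ((2 : ℝ) ^ j) ^ 8 * ((2 : ℝ) ^ i * N) ^ 4 := by
          ring
      _ ≤ ((2 : ℝ) ^ j) ^ 8 * ((#A * K * (#D : ℝ) ^ 3) * (#A * K * (#P : ℝ) ^ 3)) := by gcongr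
      _ = (#A : ℝ) ^ 2 * K ^ 2 * (#P : ℝ) ^ 3 * ((((2 : ℝ) ^ j) ^ 2 * #D) *
            (((2 : ℝ) ^ j) ^ 3 * #D) ^ 2) := by ring
      _ ≤ (#A : ℝ) ^ 2 * K ^ 2 * (#P : ℝ) ^ 3 * (fiberMoment 2 (A ×ˢ A) subPair *
            (K * (#A : ℝ) ^ 2) ^ 2) := by gcongr
      _ = _ := by ring

/-- The quotient of a pair. -/
noncomputable def divPair (p : ℝ × ℝ) : ℝ := p.1 / p.2

theorem fib_divPair_le_left {A C : Finset ℝ} (hA : 0 ∉ A) (hC : 0 ∉ C) (y : ℝ) :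
    fib (A ×ˢ C) divPair y ≤ #A := by
  refine card_le_card_of_injOn Prod.fst
    (fun p hp => (mem_product.1 (mem_filter.1 hp).1).1) fun p hp q hq h => ?_
  obtain ⟨h1, e1⟩ := mem_filter.1 (mem_coe.1 hp)
  obtain ⟨h2, e2⟩ := mem_filter.1 (mem_coe.1 hq)
  have hp1 : p.1 ≠ 0 := fun h0 => hA (h0 ▸ (mem_product.1 h1).1)
  have hp2 : p.2 ≠ 0 := fun h0 => hC (h0 ▸ (mem_product.1 h1).2)
  have hq2 : q.2 ≠ 0 := fun h0 => hC (h0 ▸ (mem_product.1 h2).2)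
  refine Prod.ext h ?_
  have e : p.1 / p.2 = q.1 / q.2 := e1.trans e2.symm
  rw [← h, div_eq_div_iff hp2 hq2] at e
  exact (mul_left_cancel₀ hp1 e).symm

theorem fib_divPair_le_right {A C : Finset ℝ} (hC : 0 ∉ C) (y : ℝ) :
    fib (A ×ˢ C) divPair y ≤ #C := by
  refine card_le_card_of_injOn Prod.snd
    (fun p hp => (mem_product.1 (mem_filter.1 hp).1).2) fun p hp q hq h => ?_
  obtain ⟨h1, e1⟩ := mem_filter.1 (mem_coe.1 hp)
  obtain ⟨-, e2⟩ := mem_filter.1 (mem_coe.1 hq)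
  have hp2 : p.2 ≠ 0 := fun h0 => hC (h0 ▸ (mem_product.1 h1).2)
  refine Prod.ext ?_ h
  have e : p.1 / p.2 = q.1 / q.2 := e1.trans e2.symm
  rw [← h] at e
  exact (div_left_inj' hp2).1 e

/-- The sum of a pair. -/
def addPair (p : ℝ × ℝ) : ℝ := p.1 + p.2

theorem fib_addPair_le_left (D B : Finset ℝ) (a : ℝ) : fib (D ×ˢ B) addPair a ≤ #D := by
  refine card_le_card_of_injOn Prod.fst
    (fun p hp => (mem_product.1 (mem_filter.1 hp).1).1) fun p hp q hq h => ?_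
  have e : p.1 + p.2 = q.1 + q.2 := (mem_filter.1 hp).2.trans (mem_filter.1 hq).2.symm
  exact Prod.ext h (by linarith)

theorem fib_addPair_le_right (D B : Finset ℝ) (a : ℝ) : fib (D ×ˢ B) addPair a ≤ #B := by
  refine card_le_card_of_injOn Prod.snd
    (fun p hp => (mem_product.1 (mem_filter.1 hp).1).2) fun p hp q hq h => ?_
  have e : p.1 + p.2 = q.1 + q.2 := (mem_filter.1 hp).2.trans (mem_filter.1 hq).2.symm
  exact Prod.ext (by linarith) h

theorem sum_fib_addPair_le_incidences (A C D B S : Finset ℝ) (hC : 0 ∉ C) :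
    ∑ y ∈ S, ∑ p ∈ A ×ˢ C with divPair p = y, fib (D ×ˢ B) addPair p.1 ≤
      ∑ l ∈ C ×ˢ D, #(pointsOn B S l) := by
  have h : ∑ y ∈ S, ∑ p ∈ A ×ˢ C with divPair p = y, fib (D ×ˢ B) addPair p.1 =
      #(S.sigma fun y => ({p ∈ A ×ˢ C | divPair p = y}).sigma fun p =>
        {w ∈ D ×ˢ B | addPair w = p.1}) := by
    rw [card_sigma]
    exact sum_congr rfl fun y _ => (card_sigma _ _).symm
  rw [h, ← card_sigma]
  refine card_le_card_of_injOn
    (fun w => ⟨(w.2.1.2, w.2.2.1), (w.2.2.2, w.1)⟩) ?_ ?_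
  · rintro ⟨y, ⟨a, c⟩, x, b⟩ hw
    simp only [coe_sigma, Set.mem_sigma_iff, mem_coe, mem_filter, mem_product] at hw
    obtain ⟨hy, ⟨⟨-, hc⟩, hac⟩, ⟨hx, hb⟩, hxb⟩ := hw
    simp only [coe_sigma, Set.mem_sigma_iff, mem_coe, mem_product, pointsOn, mem_filter]
    simp only [divPair, addPair] at hac hxb
    refine ⟨⟨hc, hx⟩, ⟨hb, hy⟩, ?_⟩
    rw [← hac, hxb, div_mul_cancel₀]
    exact fun h0 => hC (h0 ▸ hc)
  · rintro ⟨y, ⟨a, c⟩, x, b⟩ hw ⟨y', ⟨a', c'⟩, x', b'⟩ hw' heq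
    simp only [coe_sigma, Set.mem_sigma_iff, mem_coe, mem_filter] at hw hw'
    simp only [Sigma.mk.injEq, heq_eq_eq, Prod.mk.injEq] at heq
    obtain ⟨⟨rfl, rfl⟩, rfl, rfl⟩ := heq
    obtain rfl : a = a' := hw.2.2.2.symm.trans hw'.2.2.2
    rfl

/-- If every element of `A` has at least `q` representations in `D + B`, the level sets of the
quotient representation function of `A` and `C` are small. -/
theorem cube_mul_card_level_le {A C D B S : Finset ℝ} (hA : 0 ∉ A) (hC : 0 ∉ C) {q : ℝ}
    (hq : 0 ≤ q) (hr : ∀ a ∈ A, q ≤ fib (D ×ˢ B) addPair a) {s : ℕ} (hs : 0 < s)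
    (hS : ∀ y ∈ S, s ≤ fib (A ×ˢ C) divPair y) :
    q ^ 3 * ((s : ℝ) ^ 3 * #S) ≤ 324 * ((#C : ℝ) * #D * #B) ^ 2 := by
  rcases S.eq_empty_or_nonempty with rfl | ⟨y, hy⟩
  · simp only [card_empty, Nat.cast_zero, mul_zero]; positivity
  have hsA : (s : ℝ) ≤ #A := by exact_mod_cast (hS y hy).trans (fib_divPair_le_left hA hC y)
  have hsC : (s : ℝ) ≤ #C := by exact_mod_cast (hS y hy).trans (fib_divPair_le_right hC y)
  have hApos : 0 < #A := by
    have := (hS y hy).trans (fib_divPair_le_left hA hC y)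
    omega
  obtain ⟨a, ha⟩ := card_pos.1 hApos
  have hqB : q ≤ #B := (hr a ha).trans (by exact_mod_cast fib_addPair_le_right D B a)
  have hqA : #A * q ≤ #D * #B := by
    calc #A * q = ∑ _a ∈ A, q := by rw [sum_const, nsmul_eq_mul]
      _ ≤ ∑ a ∈ A, (fib (D ×ˢ B) addPair a : ℝ) := sum_le_sum hr
      _ ≤ (fiberMoment 1 (D ×ˢ B) addPair : ℕ) := by
        have := sum_fib_pow_le one_ne_zero (D ×ˢ B) addPair A
        simp only [pow_one] at this
        exact_mod_cast this
      _ = _ := by rw [fiberMoment_one, card_product, Nat.cast_mul]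
  set I := ∑ l ∈ C ×ˢ D, #(pointsOn B S l) with hI
  have hIlow : q * (s * #S) ≤ I := by
    have h1 : ∀ y ∈ S, q * s ≤
        ∑ p ∈ A ×ˢ C with divPair p = y, (fib (D ×ˢ B) addPair p.1 : ℝ) := by
      intro y hy
      calc q * s ≤ q * fib (A ×ˢ C) divPair y := by gcongr; exact hS y hy
        _ = ∑ p ∈ A ×ˢ C with divPair p = y, q := by
          rw [sum_const, nsmul_eq_mul, mul_comm]; rfl
        _ ≤ _ := sum_le_sum fun p hp => hr _ (mem_product.1 (mem_filter.1 hp).1).1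
    calc q * (s * #S) = ∑ _y ∈ S, q * s := by rw [sum_const, nsmul_eq_mul]; ring
      _ ≤ ∑ y ∈ S, ∑ p ∈ A ×ˢ C with divPair p = y, (fib (D ×ˢ B) addPair p.1 : ℝ) :=
        sum_le_sum h1
      _ ≤ I := by exact_mod_cast sum_fib_addPair_le_incidences A C D B S hC
  have hSpos : (0 : ℝ) < #S := by exact_mod_cast card_pos.2 ⟨y, hy⟩
  have hL : ∀ l ∈ C ×ˢ D, l.1 ≠ 0 := fun l hl h0 => hC (h0 ▸ (mem_product.1 hl).1)
  rcases le_or_gt (4 * #(C ×ˢ D)) I with h4 | h4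
  · have h5 : (I : ℝ) ^ 3 ≤ 324 * ((#C * #D : ℝ) ^ 2 * (#B * #S) ^ 2) := by
      have := sum_card_pointsOn_cube_le B S hL h4
      rw [card_product] at this
      exact_mod_cast this
    refine le_of_mul_le_mul_right ?_ (pow_pos hSpos 2)
    calc q ^ 3 * ((s : ℝ) ^ 3 * #S) * (#S : ℝ) ^ 2 = (q * (s * #S)) ^ 3 := by ring
      _ ≤ (I : ℝ) ^ 3 := by gcongr
      _ ≤ _ := h5
      _ = _ := by ring
  · have h5 : q * (s * #S) ≤ 4 * (#C * #D) := by
      refine hIlow.trans ?_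
      rw [card_product] at h4
      exact_mod_cast h4.le
    calc q ^ 3 * ((s : ℝ) ^ 3 * #S) = (q * (s * #S)) * (s * (q * (s * q))) := by ring
      _ ≤ (4 * (#C * #D)) * (#C * (#B * (#A * q))) := by gcongr
      _ ≤ (4 * (#C * #D)) * (#C * (#B * (#D * #B))) := by gcongr
      _ = 4 * ((#C : ℝ) * #D * #B) ^ 2 := by ring
      _ ≤ _ := by gcongr; norm_num

theorem cube_mul_fiberMoment_divPair_le {A C D B : Finset ℝ} (hA : 0 ∉ A) (hC : 0 ∉ C) {q : ℝ}
    (hq : 0 ≤ q) (hr : ∀ a ∈ A, q ≤ fib (D ×ˢ B) addPair a) {J : ℕ} (hJ : 0 < J)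
    (hAJ : #A < 2 ^ J) :
    q ^ 3 * fiberMoment 3 (A ×ˢ C) divPair ≤ 2592 * J * ((#C : ℝ) * #D * #B) ^ 2 := by
  obtain ⟨i, -, hi⟩ := exists_fiberMoment_le_level hJ three_ne_zero
    fun y => (fib_divPair_le_left hA hC y).trans_lt hAJ
  have h := cube_mul_card_level_le hA hC hq hr (s := 2 ^ i)
    (S := fiberLevel (A ×ˢ C) divPair i) (by positivity) fun y hy => (mem_fiberLevel.1 hy).1
  have hi' : (fiberMoment 3 (A ×ˢ C) divPair : ℝ) ≤
      J * ((2 ^ (i + 1)) ^ 3 * #(fiberLevel (A ×ˢ C) divPair i)) := by exact_mod_cast hi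
  push_cast at h
  calc q ^ 3 * (fiberMoment 3 (A ×ˢ C) divPair : ℝ)
      ≤ q ^ 3 * (J * ((2 ^ (i + 1)) ^ 3 * #(fiberLevel (A ×ˢ C) divPair i))) := by gcongr
    _ = 8 * J * (q ^ 3 * ((2 ^ i) ^ 3 * #(fiberLevel (A ×ˢ C) divPair i))) := by ring
    _ ≤ 8 * J * (324 * ((#C : ℝ) * #D * #B) ^ 2) := by gcongr
    _ = _ := by ring

/-- Dyadic pigeonholing: a function whose average over `Y` is at least `2 Q / m` is large on a
subset of `Y` carrying a logarithmic proportion of its mass. -/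
theorem exists_subset_dyadic {α : Type*} {Y : Finset α} {r : α → ℕ} {m Q J : ℕ} (hQ : 0 < Q)
    (hJ : 0 < J) (hY : 4 * #Y ≤ m) (hr : ∀ a ∈ Y, m * r a < Q * 2 ^ J)
    (hsum : Q ≤ 2 * ∑ a ∈ Y, r a) :
    ∃ j, ∃ A ⊆ Y, (∀ a ∈ A, Q * 2 ^ j ≤ m * r a) ∧ m ≤ 8 * J * 2 ^ j * #A := by
  classical
  set w : α → ℕ := fun a => m * r a / Q with hw
  set L : ℕ → Finset α := fun j => {a ∈ Y | 0 < w a ∧ Nat.log 2 (w a) = j} with hL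
  have hpt : ∀ a ∈ Y, m * r a ≤ Q + Q * ∑ j ∈ range J, if a ∈ L j then 2 ^ (j + 1) else 0 := by
    intro a ha
    rcases Nat.eq_zero_or_pos (w a) with h0 | h0
    · exact ((Nat.div_eq_zero_iff_lt hQ).1 h0).le.trans (Nat.le_add_right _ _)
    · have hlog : Nat.log 2 (w a) ∈ range J :=
        mem_range.2 (Nat.log_lt_of_lt_pow h0.ne' (Nat.div_lt_of_lt_mul (hr a ha)))
      have hmem : a ∈ L (Nat.log 2 (w a)) := mem_filter.2 ⟨ha, h0, rfl⟩
      have h1 := single_le_sum (f := fun j => if a ∈ L j then 2 ^ (j + 1) else 0)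
        (fun _ _ => Nat.zero_le _) hlog
      simp only [hmem, if_true] at h1
      have h2 : w a < 2 ^ (Nat.log 2 (w a) + 1) := Nat.lt_pow_succ_log_self one_lt_two _
      have h3 : m * r a < Q * 2 ^ (Nat.log 2 (w a) + 1) := by
        rw [mul_comm Q]; exact (Nat.div_lt_iff_lt_mul hQ).1 h2
      exact h3.le.trans ((Nat.mul_le_mul_left Q h1).trans (Nat.le_add_left _ _))
  have hswap : ∑ a ∈ Y, ∑ j ∈ range J, (if a ∈ L j then 2 ^ (j + 1) else 0) =
      ∑ j ∈ range J, 2 ^ (j + 1) * #(L j) := by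
    rw [sum_comm]
    refine sum_congr rfl fun j _ => ?_
    rw [← sum_filter, sum_const, smul_eq_mul, mul_comm]
    congr 2
    ext a
    simp only [hL, mem_filter]
    tauto
  have htot := sum_le_sum hpt
  rw [← mul_sum, sum_add_distrib, ← mul_sum, hswap, sum_const, smul_eq_mul] at htot
  have hm : m ≤ ∑ j ∈ range J, 4 * (2 ^ (j + 1) * #(L j)) := by
    rw [← mul_sum]
    set R := ∑ j ∈ range J, 2 ^ (j + 1) * #(L j)
    refine Nat.le_of_mul_le_mul_left ?_ hQ
    have h1 := Nat.mul_le_mul_left m hsum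
    have h2 := Nat.mul_le_mul_left Q hY
    have h3 : Q * (4 * R) = 4 * (Q * R) := by ring
    have h4 : m * (2 * ∑ a ∈ Y, r a) = 2 * (m * ∑ a ∈ Y, r a) := by ring
    have h5 : Q * (4 * #Y) = 4 * (#Y * Q) := by ring
    rw [mul_comm m Q] at h1
    omega
  obtain ⟨j, -, hj⟩ := exists_le_mul_of_le_sum hJ hm
  refine ⟨j, L j, filter_subset _ _, fun a ha => ?_, hj.trans_eq (by ring)⟩
  obtain ⟨-, h0, rfl⟩ := mem_filter.1 ha
  calc Q * 2 ^ Nat.log 2 (w a) ≤ Q * w a := Nat.mul_le_mul_left Q (Nat.pow_log_le_self 2 h0.ne')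
    _ ≤ m * r a := Nat.mul_div_le _ _

theorem sum_fib_subPair_le (X B D : Finset ℝ) :
    ∑ x ∈ D, fib (X ×ˢ B) subPair x ≤ ∑ a ∈ X, fib (D ×ˢ B) addPair a := by
  simp only [fib]
  rw [← card_sigma, ← card_sigma]
  refine card_le_card_of_injOn (fun w => ⟨w.2.1, (w.1, w.2.2)⟩) ?_ ?_
  · rintro ⟨x, a, b⟩ hw
    simp only [coe_sigma, Set.mem_sigma_iff, mem_coe, mem_filter, mem_product] at hw
    obtain ⟨hx, ⟨ha, hb⟩, h⟩ := hw
    simp only [coe_sigma, Set.mem_sigma_iff, mem_coe, mem_filter, mem_product]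
    simp only [subPair, addPair] at h ⊢
    exact ⟨ha, ⟨hx, hb⟩, by linarith⟩
  · rintro ⟨x, a, b⟩ - ⟨x', a', b'⟩ - heq
    simp only [Sigma.mk.injEq, heq_eq_eq, Prod.mk.injEq] at heq
    obtain ⟨rfl, rfl, rfl⟩ := heq
    rfl

/-- If a set has many additive coincidences with some other set, then it has a subset with few
multiplicative coincidences with every set. -/
theorem exists_subset_fiberMoment_divPair_le {X B : Finset ℝ} {J : ℕ} (hJ : 0 < J)
    (hXJ : #X < 2 ^ J) {d : ℝ} (hd : 1 ≤ d)
    (h : 8 * J * d * #X * (#B : ℝ) ^ 2 < fiberMoment 3 (X ×ˢ B) subPair) :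
    ∃ A ⊆ X, 0 ∉ A ∧ A.Nonempty ∧ ∀ C : Finset ℝ, 0 ∉ C →
      d * #X * fiberMoment 3 (A ×ˢ C) divPair ≤
        4096 * 2592 * (J : ℝ) ^ 4 * (#A : ℝ) ^ 3 * (#C : ℝ) ^ 2 := by
  obtain ⟨i, -, hi⟩ := exists_fiberMoment_le_level hJ three_ne_zero
    fun y => (fib_subPair_le X B y).trans_lt hXJ
  set D := fiberLevel (X ×ˢ B) subPair i with hD
  have hJ0 : (0 : ℝ) < J := by exact_mod_cast hJ
  have hlow : d * #X * (#B : ℝ) ^ 2 < (2 ^ i) ^ 3 * #D := by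
    have h1 : (fiberMoment 3 (X ×ˢ B) subPair : ℝ) ≤ J * ((2 ^ (i + 1)) ^ 3 * #D) := by
      exact_mod_cast hi
    refine lt_of_mul_lt_mul_left ?_ (by positivity : (0 : ℝ) ≤ 8 * J)
    calc 8 * J * (d * #X * (#B : ℝ) ^ 2) = 8 * J * d * #X * (#B : ℝ) ^ 2 := by ring
      _ < _ := h.trans_le h1
      _ = _ := by ring
  have hDX : 2 ^ i * #D ≤ #X * #B := by
    have := pow_mul_card_le_fiberMoment one_ne_zero (s := X ×ˢ B) (f := subPair) (T := D)
      fun y hy => (mem_fiberLevel.1 hy).1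
    rwa [pow_one, fiberMoment_one, card_product] at this
  have hD0 : 0 < #D := by
    rcases Nat.eq_zero_or_pos #D with h0 | h0
    · rw [h0] at hlow
      have : 0 ≤ d * #X * (#B : ℝ) ^ 2 := by positivity
      simp only [Nat.cast_zero, mul_zero] at hlow
      linarith
    · exact h0
  have hXB : 0 < #X * #B := lt_of_lt_of_le (by positivity) hDX
  have hX0 : 0 < #X := Nat.pos_of_mul_pos_right hXB
  have hB0 : 0 < #B := Nat.pos_of_mul_pos_left hXB
  have hi0 : i ≠ 0 := by
    rintro hi0
    rw [hi0] at hlow hDX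
    have h1 : (#D : ℝ) ≤ #X * #B := by
      rw [pow_zero, one_mul] at hDX
      exact_mod_cast hDX
    have h2 : (1 : ℝ) ≤ #B := by exact_mod_cast hB0
    have h3 : 1 * #X * (#B * 1 : ℝ) ≤ d * #X * (#B * #B) := by gcongr
    simp only [pow_zero, one_pow, one_mul] at hlow
    linarith [sq (#B : ℝ)]
  have hi2 : 2 ≤ 2 ^ i := Nat.le_self_pow hi0 2
  have hQsum : 2 ^ i * #D ≤ 2 * ∑ a ∈ X.erase 0, fib (D ×ˢ B) addPair a := by
    have h1 : 2 ^ i * #D ≤ ∑ x ∈ D, fib (X ×ˢ B) subPair x := by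
      rw [mul_comm, ← smul_eq_mul]
      exact card_nsmul_le_sum _ _ _ fun y hy => (mem_fiberLevel.1 hy).1
    have h2 : ∑ a ∈ X, fib (D ×ˢ B) addPair a ≤
        #D + ∑ a ∈ X.erase 0, fib (D ×ˢ B) addPair a := by
      by_cases h0 : (0 : ℝ) ∈ X
      · rw [← add_sum_erase X _ h0]
        exact Nat.add_le_add_right (fib_addPair_le_left D B 0) _
      · rw [erase_eq_of_notMem h0]
        exact Nat.le_add_left _ _
    have h3 := sum_fib_subPair_le X B D
    have h4 : 2 * #D ≤ 2 ^ i * #D := Nat.mul_le_mul_right _ hi2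
    omega
  obtain ⟨j, A, hAX, hA, hm⟩ := exists_subset_dyadic (m := 4 * #X) (J := J + 1)
    (by positivity : 0 < 2 ^ i * #D) J.succ_pos
    (Nat.mul_le_mul_left 4 (card_le_card (erase_subset 0 X)))
    (fun a _ => by
      calc 4 * #X * fib (D ×ˢ B) addPair a ≤ 4 * #X * #D := by
            gcongr; exact fib_addPair_le_left D B a
        _ < 4 * 2 ^ J * #D := by gcongr
        _ = 2 * #D * 2 ^ (J + 1) := by ring
        _ ≤ _ := by gcongr) hQsum
  have hA0 : 0 ∉ A := fun h0 => notMem_erase _ _ (hAX h0)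
  have hAX' : A ⊆ X := hAX.trans (erase_subset _ _)
  have hAne : A.Nonempty := by
    rw [nonempty_iff_ne_empty]
    rintro rfl
    simp only [card_empty, mul_zero] at hm
    omega
  refine ⟨A, hAX', hA0, hAne, fun C hC => ?_⟩
  have hX0' : (0 : ℝ) < #X := by exact_mod_cast hX0
  have hD0' : (0 : ℝ) < #D := by exact_mod_cast hD0
  have hB0' : (0 : ℝ) < #B := by exact_mod_cast hB0
  set Q : ℝ := 2 ^ i * #D with hQ
  set q : ℝ := Q * 2 ^ j / (4 * #X) with hq
  have hq0 : 0 ≤ q := by positivity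
  have hr : ∀ a ∈ A, q ≤ fib (D ×ˢ B) addPair a := fun a ha => by
    rw [hq, div_le_iff₀ (by positivity), mul_comm (fib _ _ _ : ℝ), hQ]
    exact_mod_cast hA a ha
  have hM := cube_mul_fiberMoment_divPair_le hA0 hC hq0 hr hJ
    ((card_le_card hAX').trans_lt hXJ)
  have hQq : Q ≤ 16 * J * (q * #A) := by
    have h1 : (4 * #X : ℝ) ≤ 16 * J * 2 ^ j * #A := by
      have h2 : 4 * #X ≤ 16 * J * 2 ^ j * #A := by
        refine hm.trans ?_
        gcongr ?_ * _ * _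
        omega
      exact_mod_cast h2
    have h3 : 16 * J * (q * #A) = Q * (16 * J * 2 ^ j * #A) / (4 * #X) := by rw [hq]; ring
    rw [h3, le_div_iff₀ (by positivity)]
    gcongr
  set M : ℝ := ((fiberMoment 3 (A ×ˢ C) divPair : ℕ) : ℝ)
  have hM0 : 0 ≤ M := Nat.cast_nonneg _
  refine le_of_mul_le_mul_right ?_ (by positivity : (0 : ℝ) < (#B : ℝ) ^ 2 * (#D : ℝ) ^ 2)
  calc d * #X * M * ((#B : ℝ) ^ 2 * (#D : ℝ) ^ 2)
      = d * #X * (#B : ℝ) ^ 2 * ((#D : ℝ) ^ 2 * M) := by ring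
    _ ≤ (2 ^ i) ^ 3 * #D * ((#D : ℝ) ^ 2 * M) := by gcongr
    _ = Q ^ 3 * M := by rw [hQ]; ring
    _ ≤ (16 * J * (q * #A)) ^ 3 * M := by gcongr
    _ = 4096 * J ^ 3 * #A ^ 3 * (q ^ 3 * M) := by ring
    _ ≤ 4096 * J ^ 3 * #A ^ 3 * (2592 * J * ((#C : ℝ) * #D * #B) ^ 2) := by gcongr
    _ = _ := by ring

theorem fib_union_product {α β γ : Type*} [DecidableEq α] [DecidableEq γ] {Y A : Finset α}
    (hYA : Disjoint Y A) (C : Finset β) (f : α × β → γ) (y : γ) :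
    fib ((Y ∪ A) ×ˢ C) f y = fib (Y ×ˢ C) f y + fib (A ×ˢ C) f y := by
  classical
  rw [fib, fib, fib, union_product, filter_union, card_union_of_disjoint]
  exact disjoint_filter_filter (disjoint_product.2 (Or.inl hYA))

theorem fiberMoment_three_union_le {α β γ : Type*} [DecidableEq α] [DecidableEq γ]
    {Y A : Finset α} (hYA : Disjoint Y A) (C : Finset β) (f : α × β → γ) {k R : ℝ}
    (hk : 0 ≤ k)
    (hY : k * fiberMoment 3 (Y ×ˢ C) f ≤ R * (#Y : ℝ) ^ 3)
    (hA : k * fiberMoment 3 (A ×ˢ C) f ≤ R * (#A : ℝ) ^ 3) :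
    k * fiberMoment 3 ((Y ∪ A) ×ˢ C) f ≤ R * (#(Y ∪ A) : ℝ) ^ 3 := by
  rcases Y.eq_empty_or_nonempty with rfl | hY0
  · simpa only [empty_union] using hA
  rcases A.eq_empty_or_nonempty with rfl | hA0
  · simpa only [union_empty] using hY
  have hy : (0 : ℝ) < #Y := by exact_mod_cast hY0.card_pos
  have ha : (0 : ℝ) < #A := by exact_mod_cast hA0.card_pos
  have hpt : ∀ u v : ℝ, 0 ≤ u → 0 ≤ v → (#A : ℝ) ^ 2 * #Y ^ 2 * (u + v) ^ 3 ≤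
      (#Y + #A) ^ 2 * (#A ^ 2 * u ^ 3 + #Y ^ 2 * v ^ 3) := by
    intro u v hu hv
    set a : ℝ := ((#A : ℕ) : ℝ)
    set y : ℝ := ((#Y : ℕ) : ℝ)
    obtain ⟨p, rfl⟩ : ∃ p, u = y * p := ⟨u / y, by field_simp⟩
    obtain ⟨q, rfl⟩ : ∃ q, v = a * q := ⟨v / a, by field_simp⟩
    have hp : 0 ≤ p := nonneg_of_mul_nonneg_right hu hy
    have hq : 0 ≤ q := nonneg_of_mul_nonneg_right hv ha
    have : 0 ≤ a ^ 2 * y ^ 2 * (y * a * (p - q) ^ 2 * ((2 * y + a) * p + (y + 2 * a) * q)) := by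
      positivity
    linarith
  set T := ((Y ∪ A) ×ˢ C).image f
  have hsum : (#A : ℝ) ^ 2 * #Y ^ 2 * fiberMoment 3 ((Y ∪ A) ×ˢ C) f ≤
      (#Y + #A) ^ 2 *
        (#A ^ 2 * fiberMoment 3 (Y ×ˢ C) f + #Y ^ 2 * fiberMoment 3 (A ×ˢ C) f) := by
    have h1 : (∑ z ∈ T, (fib (Y ×ˢ C) f z : ℝ) ^ 3) ≤ fiberMoment 3 (Y ×ˢ C) f := by
      exact_mod_cast sum_fib_pow_le three_ne_zero (Y ×ˢ C) f T
    have h2 : (∑ z ∈ T, (fib (A ×ˢ C) f z : ℝ) ^ 3) ≤ fiberMoment 3 (A ×ˢ C) f := by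
      exact_mod_cast sum_fib_pow_le three_ne_zero (A ×ˢ C) f T
    calc (#A : ℝ) ^ 2 * #Y ^ 2 * fiberMoment 3 ((Y ∪ A) ×ˢ C) f
        = ∑ z ∈ T, (#A : ℝ) ^ 2 * #Y ^ 2 *
            ((fib (Y ×ˢ C) f z : ℝ) + fib (A ×ˢ C) f z) ^ 3 := by
          rw [fiberMoment, Nat.cast_sum, mul_sum]
          refine sum_congr rfl fun z _ => ?_
          rw [fib_union_product hYA, Nat.cast_pow, Nat.cast_add]
      _ ≤ ∑ z ∈ T, (#Y + #A : ℝ) ^ 2 *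
            (#A ^ 2 * (fib (Y ×ˢ C) f z : ℝ) ^ 3 + #Y ^ 2 * (fib (A ×ˢ C) f z : ℝ) ^ 3) :=
          sum_le_sum fun z _ => hpt _ _ (Nat.cast_nonneg _) (Nat.cast_nonneg _)
      _ = (#Y + #A : ℝ) ^ 2 * (#A ^ 2 * ∑ z ∈ T, (fib (Y ×ˢ C) f z : ℝ) ^ 3 +
            #Y ^ 2 * ∑ z ∈ T, (fib (A ×ˢ C) f z : ℝ) ^ 3) := by
          rw [← mul_sum, sum_add_distrib, mul_sum, mul_sum]
      _ ≤ _ := by gcongr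
  rw [card_union_of_disjoint hYA, Nat.cast_add]
  refine le_of_mul_le_mul_left ?_ (by positivity : (0 : ℝ) < #A ^ 2 * #Y ^ 2)
  calc (#A : ℝ) ^ 2 * #Y ^ 2 * (k * fiberMoment 3 ((Y ∪ A) ×ˢ C) f)
      = k * (#A ^ 2 * #Y ^ 2 * fiberMoment 3 ((Y ∪ A) ×ˢ C) f) := by ring
    _ ≤ k * ((#Y + #A) ^ 2 *
        (#A ^ 2 * fiberMoment 3 (Y ×ˢ C) f + #Y ^ 2 * fiberMoment 3 (A ×ˢ C) f)) := by gcongr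
    _ = (#Y + #A : ℝ) ^ 2 * (#A ^ 2 * (k * fiberMoment 3 (Y ×ˢ C) f) +
        #Y ^ 2 * (k * fiberMoment 3 (A ×ˢ C) f)) := by ring
    _ ≤ (#Y + #A : ℝ) ^ 2 * (#A ^ 2 * (R * #Y ^ 3) + #Y ^ 2 * (R * #A ^ 3)) := by gcongr
    _ = _ := by ring

/-- A set splits into a part with few multiplicative coincidences and a part with few additive
coincidences; the larger part is returned. -/
theorem exists_large_subset_fiberMoment_le {A : Finset ℝ} {J : ℕ} (hJ : 0 < J)
    (hAJ : #A < 2 ^ J) {d : ℝ} (hd : 1 ≤ d) :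
    ∃ X ⊆ A, #A ≤ 2 * #X ∧
      ((0 ∉ X ∧ ∀ C : Finset ℝ, 0 ∉ C → d * #A * fiberMoment 3 (X ×ˢ C) divPair ≤
          2 * (4096 * 2592) * (J : ℝ) ^ 4 * (#C : ℝ) ^ 2 * (#X : ℝ) ^ 3) ∨
        ∀ B : Finset ℝ,
          (fiberMoment 3 (X ×ˢ B) subPair : ℝ) ≤ 8 * J * d * #X * (#B : ℝ) ^ 2) := by
  classical
  set P : Finset ℝ → Prop := fun Y => 0 ∉ Y ∧ ∀ C : Finset ℝ, 0 ∉ C →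
    d * #A * fiberMoment 3 (Y ×ˢ C) divPair ≤
      2 * (4096 * 2592) * (J : ℝ) ^ 4 * (#C : ℝ) ^ 2 * (#Y : ℝ) ^ 3 with hP
  have hne : ({Y ∈ A.powerset | P Y} : Finset _).Nonempty := by
    refine ⟨∅, mem_filter.2 ⟨empty_mem_powerset A, notMem_empty 0, fun C _ => ?_⟩⟩
    simp [fiberMoment]
  obtain ⟨Y, hY, hmax⟩ := exists_max_image _ card hne
  obtain ⟨hYA, hPY⟩ := mem_filter.1 hY
  rw [mem_powerset] at hYA
  by_cases hn : #A ≤ 2 * #Y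
  · exact ⟨Y, hYA, hn, Or.inl hPY⟩
  have hcard : #(A \ Y) = #A - #Y := card_sdiff_of_subset hYA
  refine ⟨A \ Y, sdiff_subset, by omega, Or.inr fun B => ?_⟩
  by_contra! hB
  obtain ⟨A', hA', hA0, hAne, hAC⟩ := exists_subset_fiberMoment_divPair_le hJ
    ((card_le_card sdiff_subset).trans_lt hAJ) hd hB
  have hdisj : Disjoint Y A' := disjoint_of_subset_right hA' disjoint_sdiff
  have hPU : P (Y ∪ A') := by
    refine ⟨by simp [hPY.1, hA0], fun C hC => ?_⟩
    refine fiberMoment_three_union_le hdisj C divPair (by positivity) (hPY.2 C hC) ?_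
    have h1 : (#A : ℝ) ≤ 2 * #(A \ Y) := by
      have : #A ≤ 2 * #(A \ Y) := by omega
      exact_mod_cast this
    calc d * #A * (fiberMoment 3 (A' ×ˢ C) divPair : ℝ)
        ≤ d * (2 * #(A \ Y)) * fiberMoment 3 (A' ×ˢ C) divPair := by gcongr
      _ = 2 * (d * #(A \ Y) * fiberMoment 3 (A' ×ˢ C) divPair) := by ring
      _ ≤ 2 * (4096 * 2592 * (J : ℝ) ^ 4 * (#A' : ℝ) ^ 3 * (#C : ℝ) ^ 2) := by
        gcongr 2 * ?_
        exact hAC C hC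
      _ = _ := by ring
  have h2 := hmax _ (mem_filter.2
    ⟨mem_powerset.2 (union_subset hYA (hA'.trans sdiff_subset)), hPU⟩)
  rw [card_union_of_disjoint hdisj] at h2
  have := hAne.card_pos
  omega

theorem fib_image_of_injective {ι ι' β β' : Type*} [DecidableEq ι'] [DecidableEq β]
    [DecidableEq β'] {e : ι → ι'} (he : e.Injective) {h : β → β'} (hh : h.Injective)
    {f : ι → β} {g : ι' → β'} (hfg : ∀ x, g (e x) = h (f x)) (s : Finset ι) (y : β) :
    fib (s.image e) g (h y) = fib s f y := by
  rw [fib, fib, filter_image, card_image_of_injective _ he]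
  simp only [hfg, hh.eq_iff]

theorem fiberMoment_image_of_injective {ι ι' β β' : Type*} [DecidableEq ι'] [DecidableEq β]
    [DecidableEq β'] {e : ι → ι'} (he : e.Injective) {h : β → β'} (hh : h.Injective)
    {f : ι → β} {g : ι' → β'} (hfg : ∀ x, g (e x) = h (f x)) (k : ℕ) (s : Finset ι) :
    fiberMoment k (s.image e) g = fiberMoment k s f := by
  have himg : (s.image e).image g = (s.image f).image h := by
    rw [image_image, image_image]
    exact image_congr fun x _ => hfg x
  rw [fiberMoment, himg, sum_image hh.injOn, fiberMoment]
  exact sum_congr rfl fun y _ => by rw [fib_image_of_injective he hh hfg]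

theorem mulEnergy_image_le {R : Type*} [Monoid R] [DecidableEq R] [DecidableEq (Additive Rˣ)]
    (Z : Finset (Additive Rˣ)) :
    _root_.mulEnergy (Z.image fun z => ((Additive.toMul z : Rˣ) : R)) ≤ _root_.addEnergy Z := by
  refine le_trans (card_le_card fun x hx => ?_) (card_image_le (f := fun z : Additive Rˣ ×
    Additive Rˣ × Additive Rˣ × Additive Rˣ => (((z.1.toMul : Rˣ) : R), ((z.2.1.toMul : Rˣ) : R),
      ((z.2.2.1.toMul : Rˣ) : R), ((z.2.2.2.toMul : Rˣ) : R))))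
  obtain ⟨a, b, c, d⟩ := x
  simp only [mem_filter, mem_product, mem_image] at hx
  obtain ⟨⟨⟨a, ha, rfl⟩, ⟨b, hb, rfl⟩, ⟨c, hc, rfl⟩, d, hd, rfl⟩, h⟩ := hx
  refine mem_image.2 ⟨(a, b, c, d), mem_filter.2 ⟨?_, ?_⟩, rfl⟩
  · simp only [mem_product]
    exact ⟨ha, hb, hc, hd⟩
  · apply Additive.toMul.injective
    apply Units.ext
    simpa using h

theorem mulEnergy_pow_le {Y : Finset ℝ} (hY : 0 ∉ Y) {J : ℕ} (hJ : 0 < J) (hYJ : #Y < 2 ^ J)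
    {K : ℝ} (hK : 0 ≤ K) (H : ∀ C : Finset ℝ, 0 ∉ C →
      (fiberMoment 3 (Y ×ˢ C) divPair : ℝ) ≤ K * (#C : ℝ) ^ 2) :
    (_root_.mulEnergy Y : ℝ) ^ 26 ≤ 2 ^ 68 * (J : ℝ) ^ 34 * (#Y : ℝ) ^ 50 * K ^ 14 := by
  classical
  set ψ : Additive ℝˣ → ℝ := fun z => ((Additive.toMul z : ℝˣ) : ℝ) with hψ
  have hinj : ψ.Injective := Units.val_injective.comp Additive.toMul.injective
  obtain ⟨Z, rfl⟩ : ∃ Z : Finset (Additive ℝˣ), Z.image ψ = Y := by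
    refine ⟨Y.preimage ψ hinj.injOn, ?_⟩
    rw [image_preimage, filter_true_of_mem]
    exact fun y hy => ⟨Additive.ofMul (Units.mk0 y fun h0 => hY (h0 ▸ hy)), rfl⟩
  rw [card_image_of_injective _ hinj] at hYJ ⊢
  have hE : _root_.mulEnergy (Z.image ψ) ≤ fiberMoment 2 (Z ×ˢ Z) subPair :=
    (mulEnergy_image_le Z).trans (addEnergy_le_fiberMoment_two Z)
  refine (pow_le_pow_left₀ (Nat.cast_nonneg _) (Nat.cast_le.2 hE) 26).trans ?_
  refine fiberMoment_two_pow_le hJ hYJ hK fun B => ?_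
  have h1 := H (B.image ψ) fun h0 => by
    obtain ⟨z, -, hz⟩ := mem_image.1 h0
    exact Units.ne_zero _ hz
  rw [card_image_of_injective _ hinj] at h1
  have h2 : fiberMoment 3 (Z.image ψ ×ˢ B.image ψ) divPair = fiberMoment 3 (Z ×ˢ B) subPair := by
    rw [← prodMap_image_product]
    refine fiberMoment_image_of_injective (hinj.prodMap hinj) hinj (fun x => ?_) 3 _
    simp [divPair, subPair, hψ, Prod.map]
  rwa [h2] at h1

theorem exists_large_subset_min_energy_pow_le (A : Finset ℝ) {J : ℕ} (hJ : 0 < J)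
    (hAJ : #A < 2 ^ J) (hA : A.Nonempty) :
    ∃ X ⊆ A, #A ≤ 2 * #X ∧ (min (_root_.addEnergy X) (_root_.mulEnergy X) : ℝ) ^ 26 ≤
      2 ^ 68 * (2 * (4096 * 2592)) ^ 14 * (J : ℝ) ^ 90 * (#A : ℝ) ^ 71 := by
  have hJ1 : (1 : ℝ) ≤ J := by exact_mod_cast hJ
  have hn1 : (1 : ℝ) ≤ #A := by exact_mod_cast hA.card_pos
  have hd : 1 ≤ √(#A : ℝ) := Real.one_le_sqrt.2 hn1
  have hdd : √(#A : ℝ) ^ 2 = #A := Real.sq_sqrt (Nat.cast_nonneg _)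
  obtain ⟨X, hXA, hX, h⟩ := exists_large_subset_fiberMoment_le hJ hAJ hd
  refine ⟨X, hXA, hX, ?_⟩
  have hXJ : #X < 2 ^ J := (card_le_card hXA).trans_lt hAJ
  have hXn : (#X : ℝ) ≤ #A := by exact_mod_cast card_le_card hXA
  set n : ℝ := ((#A : ℕ) : ℝ)
  set d : ℝ := √n
  have hd0 : 0 < d := by linarith
  set K : ℝ := 2 * (4096 * 2592) * (J : ℝ) ^ 4 * d ^ 3 with hK
  have hK0 : 0 ≤ K := by positivity
  have hfin : 2 ^ 68 * (J : ℝ) ^ 34 * (#X : ℝ) ^ 50 * K ^ 14 ≤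
      2 ^ 68 * (2 * (4096 * 2592)) ^ 14 * (J : ℝ) ^ 90 * n ^ 71 := by
    calc 2 ^ 68 * (J : ℝ) ^ 34 * (#X : ℝ) ^ 50 * K ^ 14
        ≤ 2 ^ 68 * (J : ℝ) ^ 34 * n ^ 50 * K ^ 14 := by gcongr
      _ = 2 ^ 68 * (2 * (4096 * 2592)) ^ 14 * (J : ℝ) ^ 90 * (n ^ 50 * (d ^ 2) ^ 21) := by
        rw [hK]; ring
      _ = _ := by rw [hdd]; ring
  have hmin : (0 : ℝ) ≤ min (_root_.addEnergy X : ℝ) (_root_.mulEnergy X) :=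
    le_min (Nat.cast_nonneg _) (Nat.cast_nonneg _)
  rcases h with ⟨hX0, h⟩ | h
  · refine (pow_le_pow_left₀ hmin (min_le_right _ _) 26).trans
      ((mulEnergy_pow_le hX0 hJ hXJ hK0 fun C hC => ?_).trans hfin)
    refine le_of_mul_le_mul_left ((h C hC).trans ?_) (by positivity : 0 < d * n)
    calc 2 * (4096 * 2592) * (J : ℝ) ^ 4 * (#C : ℝ) ^ 2 * (#X : ℝ) ^ 3
        ≤ 2 * (4096 * 2592) * (J : ℝ) ^ 4 * (#C : ℝ) ^ 2 * (d ^ 2) ^ 3 := by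
          rw [hdd]; gcongr
      _ = d * d ^ 2 * (K * (#C : ℝ) ^ 2) := by rw [hK]; ring
      _ = _ := by rw [hdd]
  · have hE : (_root_.addEnergy X : ℝ) ≤ (fiberMoment 2 (X ×ˢ X) subPair : ℕ) :=
      Nat.cast_le.2 (addEnergy_le_fiberMoment_two X)
    refine (pow_le_pow_left₀ hmin ((min_le_left _ _).trans hE) 26).trans
      ((fiberMoment_two_pow_le hJ hXJ hK0 fun B => ?_).trans hfin)
    refine (h B).trans ?_
    gcongr
    calc 8 * J * d * #X ≤ 8 * J * d * d ^ 2 := by rw [hdd]; gcongr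
      _ = 8 * (J : ℝ) ^ 1 * d ^ 3 := by ring
      _ ≤ 2 * (4096 * 2592) * (J : ℝ) ^ 4 * d ^ 3 := by gcongr <;> norm_num

theorem natLog_succ_le {n : ℕ} (hn : 2 ≤ n) :
    ((Nat.log 2 n + 1 : ℕ) : ℝ) ≤ 2 / Real.log 2 * Real.log n := by
  have h2 : 0 < Real.log 2 := Real.log_pos one_lt_two
  have h1 : Real.log 2 ≤ Real.log n := Real.log_le_log two_pos (by exact_mod_cast hn)
  have h3 : (Nat.log 2 n : ℝ) * Real.log 2 ≤ Real.log n := by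
    rw [← Real.log_pow]
    refine Real.log_le_log (by positivity) ?_
    exact_mod_cast Nat.pow_log_le_self 2 (by omega)
  rw [div_mul_eq_mul_div, le_div_iff₀ h2]
  push_cast
  linarith

theorem le_rpow_of_pow_le {x a b l n : ℝ} (ha : 0 ≤ a)
    (hl : 0 ≤ l) (hn : 0 ≤ n) (h : x ^ 26 ≤ a * (b * l) ^ 90 * n ^ 71) :
    x ≤ (a * b ^ 90) ^ (1 / 26 : ℝ) * n ^ ((3 : ℝ) - 7 / 26) * l ^ (90 / 26 : ℝ) := by
  refine le_of_pow_le_pow_left₀ (n := 26) (by norm_num) (by positivity) (h.trans_eq ?_)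
  have e1 : ((a * b ^ 90) ^ (1 / 26 : ℝ)) ^ 26 = a * b ^ 90 := by
    rw [← Real.rpow_mul_natCast (by positivity)]
    norm_num
  have e2 : (n ^ ((3 : ℝ) - 7 / 26)) ^ 26 = n ^ 71 := by
    rw [← Real.rpow_mul_natCast hn, ← Real.rpow_natCast]
    norm_num
  have e3 : (l ^ (90 / 26 : ℝ)) ^ 26 = l ^ 90 := by
    rw [← Real.rpow_mul_natCast hl, ← Real.rpow_natCast]
    norm_num
  rw [mul_pow, mul_pow, mul_pow, e1, e2, e3]
  ring

end EnergyDecomposition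

theorem shakan_energy_sum_product :
    ∃ C > (0 : ℝ), ∃ c ≥ (0 : ℝ), ∀ A : Finset ℝ, 2 ≤ A.card →
      ∃ A' ⊆ A, (A.card : ℝ) / 2 ≤ A'.card ∧
        (min (addEnergy A') (mulEnergy A') : ℝ) ≤
          C * (A.card : ℝ) ^ ((3 : ℝ) - 7 / 26) * (Real.log A.card) ^ c := by
  have h2 : 0 < Real.log 2 := Real.log_pos one_lt_two
  refine ⟨(2 ^ 68 * (2 * (4096 * 2592)) ^ 14 * (2 / Real.log 2) ^ 90) ^ (1 / 26 : ℝ),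
    by positivity, 90 / 26, by norm_num, fun A hA => ?_⟩
  obtain ⟨X, hXA, hX, h⟩ := exists_large_subset_min_energy_pow_le A
    (Nat.succ_pos (Nat.log 2 A.card)) (Nat.lt_pow_succ_log_self one_lt_two _)
    (Finset.card_pos.1 (by omega))
  refine ⟨X, hXA, ?_, ?_⟩
  · rw [div_le_iff₀ two_pos, mul_comm]
    exact_mod_cast hX
  · refine le_rpow_of_pow_le (by positivity) (Real.log_natCast_nonneg _)
      (Nat.cast_nonneg _) (h.trans ?_)
    gcongr
    exact natLog_succ_le hA
end

section
/- (Rudnev–Shkredov–Stevens, complex case) There exist constants C > 0 and c ≥ 0 such that for every finite set A ⊆ ℂ with |A| ≥ 2 there is a subset A' ⊆ A with |A'| ≥ |A|/2 and min{E⁺(A'), Eˣ(A')} ≤ C · |A|^{3 − 1/4} · (log |A|)^{c}. -/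
section
open Finset hiding addEnergy mulEnergy
open scoped Pointwise

/-- The sum of the reciprocals of the ranks of the elements of a finite set is at most harmonic. -/
lemma sum_inv_card_filter_le_harmonic {ι : Type*} [DecidableEq ι] (Z : Finset ι) (φ : ι → ℝ) :
    ∑ z ∈ Z, ((#{z' ∈ Z | φ z' ≤ φ z} : ℕ) : ℝ)⁻¹ ≤ (harmonic #Z : ℝ) := by
  induction Z using Finset.induction_on_max_value φ with
  | empty => simp
  | insert a s ha hmax ih =>
    rw [sum_insert ha, card_insert_of_notMem ha, harmonic_succ, add_comm]
    push_cast
    have hfull : {z' ∈ insert a s | φ z' ≤ φ a} = insert a s :=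
      filter_true_of_mem fun z hz => by
        rcases mem_insert.1 hz with rfl | hz
        · exact le_rfl
        · exact hmax z hz
    refine add_le_add (le_trans (sum_le_sum fun z hz => ?_) ih) ?_
    · apply inv_anti₀
      · exact_mod_cast card_pos.2 ⟨z, by simp [hz]⟩
      · exact_mod_cast card_le_card (filter_subset_filter _ (subset_insert a s))
    · rw [hfull, card_insert_of_notMem ha]
      push_cast
      exact le_rfl

/-- A three-term Hölder inequality. -/
lemma sum_pow_three_le_of_pow_three_le {ι : Type*} (s : Finset ι) {t a b c : ι → ℝ}
    (ht : ∀ i ∈ s, 0 ≤ t i) (ha : ∀ i ∈ s, 0 ≤ a i) (hb : ∀ i ∈ s, 0 ≤ b i)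
    (hc : ∀ i ∈ s, 0 ≤ c i) (h : ∀ i ∈ s, t i ^ 3 ≤ a i * b i * c i) :
    (∑ i ∈ s, t i) ^ 3 ≤ (∑ i ∈ s, a i) * (∑ i ∈ s, b i) * ∑ i ∈ s, c i := by
  have h1 : (∑ i ∈ s, √(t i * a i)) ^ 2 ≤ (∑ i ∈ s, t i) * ∑ i ∈ s, a i :=
    sum_sq_le_sum_mul_sum_of_sq_le_mul s ht ha fun i hi =>
      (Real.sq_sqrt (mul_nonneg (ht i hi) (ha i hi))).le
  have h2 : (∑ i ∈ s, √(b i * c i)) ^ 2 ≤ (∑ i ∈ s, b i) * ∑ i ∈ s, c i :=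
    sum_sq_le_sum_mul_sum_of_sq_le_mul s hb hc fun i hi =>
      (Real.sq_sqrt (mul_nonneg (hb i hi) (hc i hi))).le
  have h3 : (∑ i ∈ s, t i) ^ 2 ≤ (∑ i ∈ s, √(t i * a i)) * ∑ i ∈ s, √(b i * c i) := by
    have hle : ∑ i ∈ s, t i ≤ ∑ i ∈ s, √(√(t i * a i) * √(b i * c i)) := by
      refine sum_le_sum fun i hi => ?_
      apply Real.le_sqrt_of_sq_le
      rw [← Real.sqrt_mul (mul_nonneg (ht i hi) (ha i hi))]
      apply Real.le_sqrt_of_sq_le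
      have := mul_le_mul_of_nonneg_left (h i hi) (ht i hi)
      linarith
    refine (pow_le_pow_left₀ (sum_nonneg ht) hle 2).trans ?_
    exact sum_sq_le_sum_mul_sum_of_sq_le_mul s (fun i _ => Real.sqrt_nonneg _)
      (fun i _ => Real.sqrt_nonneg _) fun i _ =>
        (Real.sq_sqrt (mul_nonneg (Real.sqrt_nonneg _) (Real.sqrt_nonneg _))).le
  have hT := sum_nonneg ht
  have hA := sum_nonneg ha
  have hB := sum_nonneg hb
  have hC := sum_nonneg hc
  rcases hT.eq_or_lt with h0 | h0
  · rw [← h0, zero_pow three_ne_zero]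
    exact mul_nonneg (mul_nonneg hA hB) hC
  refine le_of_mul_le_mul_left ?_ h0
  calc (∑ i ∈ s, t i) * (∑ i ∈ s, t i) ^ 3 = ((∑ i ∈ s, t i) ^ 2) ^ 2 := by ring
    _ ≤ ((∑ i ∈ s, √(t i * a i)) * ∑ i ∈ s, √(b i * c i)) ^ 2 :=
        pow_le_pow_left₀ (sq_nonneg _) h3 2
    _ = (∑ i ∈ s, √(t i * a i)) ^ 2 * (∑ i ∈ s, √(b i * c i)) ^ 2 := by ring
    _ ≤ ((∑ i ∈ s, t i) * ∑ i ∈ s, a i) * ((∑ i ∈ s, b i) * ∑ i ∈ s, c i) :=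
        mul_le_mul h1 h2 (sq_nonneg _) (by positivity)
    _ = _ := by ring

/-- Two nonzero complex numbers in the same octant are closer to each other than the longer one
is to the origin. -/
lemma norm_sub_lt_of_same_octant {w w' : ℂ} (hw' : w' ≠ 0) (hle : ‖w'‖ ≤ ‖w‖)
    (hre : 0 ≤ w.re ↔ 0 ≤ w'.re) (him : 0 ≤ w.im ↔ 0 ≤ w'.im)
    (habs : |w.im| ≤ |w.re| ↔ |w'.im| ≤ |w'.re|) : ‖w - w'‖ < ‖w‖ := by
  have hpos : 0 < ‖w'‖ := norm_pos_iff.2 hw'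
  have key : ‖w'‖ ^ 2 < 2 * (w.re * w'.re + w.im * w'.im) := by
    have hr : w.re * w'.re = |w.re| * |w'.re| := by
      rw [← abs_mul, abs_of_nonneg]
      by_cases h : 0 ≤ w.re
      · exact mul_nonneg h (hre.1 h)
      · exact (mul_pos_of_neg_of_neg (not_le.1 h) (not_le.1 (mt hre.2 h))).le
    have hi : w.im * w'.im = |w.im| * |w'.im| := by
      rw [← abs_mul, abs_of_nonneg]
      by_cases h : 0 ≤ w.im
      · exact mul_nonneg h (him.1 h)
      · exact (mul_pos_of_neg_of_neg (not_le.1 h) (not_le.1 (mt him.2 h))).le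
    have e : ∀ v : ℂ, ‖v‖ ^ 2 = |v.re| ^ 2 + |v.im| ^ 2 := fun v => by
      rw [Complex.sq_norm, Complex.normSq_apply, sq_abs, sq_abs]; ring
    have h1 := pow_le_pow_left₀ hpos.le hle 2
    have h2 := pow_pos hpos 2
    rw [e] at h1 h2
    rw [e] at h1
    rw [hr, hi, e]
    have := abs_nonneg w.re
    have := abs_nonneg w.im
    have := abs_nonneg w'.re
    have := abs_nonneg w'.im
    generalize |w.re| = x at *
    generalize |w.im| = y at *
    generalize |w'.re| = x' at *
    generalize |w'.im| = y' at *
    have octant : ∀ x y x' y' : ℝ, 0 ≤ y → 0 ≤ y' → y ≤ x → y' ≤ x' →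
        x' ^ 2 + y' ^ 2 ≤ x ^ 2 + y ^ 2 → 0 < x' ^ 2 + y' ^ 2 →
        x' ^ 2 + y' ^ 2 < 2 * (x * x' + y * y') := by
      intro x y x' y' hy hy' hyx hyx' hle hpos
      have hd : (x' ^ 2 + y' ^ 2) ^ 2 ≤ (x' ^ 2 + y' ^ 2) * (x ^ 2 + y ^ 2) := by
        rw [sq]; gcongr
      have hx : 0 ≤ x := hy.trans hyx
      have hx' : 0 ≤ x' := hy'.trans hyx'
      have hcr : (x * y' - x' * y) ^ 2 ≤ (x * x' + y * y') ^ 2 := by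
        apply sq_le_sq'
        · nlinarith [mul_nonneg hx' (sub_nonneg.2 hyx), mul_nonneg hx hy', mul_nonneg hy hy']
        · nlinarith [mul_nonneg hx (sub_nonneg.2 hyx'), mul_nonneg hx' hy, mul_nonneg hy hy']
      have hD : 0 ≤ x * x' + y * y' := by positivity
      refine lt_of_pow_lt_pow_left₀ 2 (by positivity) ?_
      nlinarith [pow_pos hpos 2]
    by_cases h : y ≤ x
    · exact octant x y x' y' ‹_› ‹_› h (habs.1 h) h1 h2
    · have := octant y x y' x' ‹_› ‹_› (not_le.1 h).le (not_le.1 (mt habs.2 h)).le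
        (by linarith) (by linarith)
      linarith
  refine lt_of_pow_lt_pow_left₀ 2 (norm_nonneg _) ?_
  have e : ∀ v : ℂ, ‖v‖ ^ 2 = v.re ^ 2 + v.im ^ 2 := fun v => by
    rw [Complex.sq_norm, Complex.normSq_apply]; ring
  rw [e] at key
  rw [e, e, Complex.sub_re, Complex.sub_im]
  nlinarith

/-- At most eight points of the plane can be at least as far from each other as from `z`. -/
lemma card_le_eight_of_norm_sub_le {Z : Finset ℂ} {z : ℂ} (hz : z ∉ Z)
    (h : ∀ p ∈ Z, ∀ p' ∈ Z, p ≠ p' → ‖p - z‖ ≤ ‖p - p'‖) : #Z ≤ 8 := by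
  classical
  let oct : ℂ → Bool × Bool × Bool := fun p =>
    (decide (0 ≤ (p - z).re), decide (0 ≤ (p - z).im), decide (|(p - z).im| ≤ |(p - z).re|))
  have hinj : Set.InjOn oct Z := by
    have aux : ∀ p ∈ Z, ∀ p' ∈ Z, oct p = oct p' → ‖p' - z‖ ≤ ‖p - z‖ → p = p' := by
      intro p hp p' hp' ho hle
      by_contra hne
      simp only [oct, Prod.mk.injEq, decide_eq_decide] at ho
      have hp'z : p' - z ≠ 0 := sub_ne_zero.2 fun e => hz (e ▸ hp')
      have := norm_sub_lt_of_same_octant hp'z hle ho.1 ho.2.1 ho.2.2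
      rw [sub_sub_sub_cancel_right] at this
      exact absurd (h p hp p' hp' hne) (not_le.2 this)
    intro p hp p' hp' ho
    rcases le_total ‖p' - z‖ ‖p - z‖ with hle | hle
    · exact aux p hp p' hp' ho hle
    · exact (aux p' hp' p hp ho.symm hle).symm
  calc #Z = #(Z.image oct) := (card_image_of_injOn hinj).symm
    _ ≤ #(univ : Finset (Bool × Bool × Bool)) := card_le_card (subset_univ _)
    _ = 8 := rfl

/-- Discs around the points `f p` that reach at most to the nearest neighbour overlap boundedly
often. -/
lemma sum_card_disc_le {ι : Type*} (F : Finset ι) (P : Finset ℂ) (f : ι → ℂ)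
    (hf : Set.InjOn f F) (ρ : ι → ℝ)
    (h : ∀ p ∈ F, ∀ p' ∈ F, p ≠ p' → ρ p ≤ ‖f p - f p'‖) :
    ∑ p ∈ F, #{z ∈ P | z ≠ f p ∧ ‖z - f p‖ ≤ ρ p} ≤ 8 * #P := by
  classical
  simp_rw [card_filter]
  rw [sum_comm]
  simp_rw [← card_filter]
  rw [mul_comm, ← smul_eq_mul, ← sum_const]
  refine sum_le_sum fun z _ => ?_
  rw [← card_image_of_injOn (hf.mono (coe_subset.2 (filter_subset _ F)))]
  refine card_le_eight_of_norm_sub_le (z := z) ?_ ?_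
  · simp only [mem_image, mem_filter, not_exists, not_and]
    exact fun p hp e => hp.2.1 e.symm
  simp only [mem_image, mem_filter]
  rintro _ ⟨p, hp, rfl⟩ _ ⟨p', hp', rfl⟩ hne
  rw [norm_sub_rev]
  exact hp.2.2.trans (h p hp.1 p' hp'.1 fun e => hne (congrArg f e))

/-- The number of points of `P` other than `p` that are at most as far from `p` as `p'`. -/
noncomputable def nearCount (P : Finset ℂ) (p p' : ℂ) : ℕ :=
  #{z ∈ P | z ≠ p ∧ ‖z - p‖ ≤ ‖p' - p‖}

lemma nearCount_pos {P : Finset ℂ} {p p' : ℂ} (hp' : p' ∈ P) (hne : p' ≠ p) :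
    0 < nearCount P p p' :=
  card_pos.2 ⟨p', by simp [hp', hne]⟩

lemma harmonic_mono {m n : ℕ} (h : m ≤ n) : harmonic m ≤ harmonic n :=
  sum_le_sum_of_subset_of_nonneg (range_subset_range.2 h) fun _ _ _ => by positivity

lemma sum_offDiag_inv_nearCount_le (P : Finset ℂ) :
    ∑ q ∈ P.offDiag, (nearCount P q.1 q.2 : ℝ)⁻¹ ≤ #P * (harmonic #P : ℝ) := by
  classical
  have hoff : P.offDiag = (P ×ˢ P).filter fun q => q.1 ≠ q.2 := by
    ext q; simp [and_assoc]
  rw [hoff, sum_filter, sum_product, ← nsmul_eq_mul, ← sum_const]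
  refine sum_le_sum fun p _ => ?_
  have hmono : (harmonic #(P.erase p) : ℝ) ≤ (harmonic #P : ℝ) := by
    exact_mod_cast harmonic_mono (card_le_card (erase_subset p P))
  refine le_trans (le_of_eq ?_)
    ((sum_inv_card_filter_le_harmonic (P.erase p) fun z => ‖z - p‖).trans hmono)
  rw [← sum_filter]
  refine sum_congr ?_ fun z _ => ?_
  · ext z; simp only [mem_filter, mem_erase, ne_eq, eq_comm, and_comm]
  · congr 3
    refine congrArg card ?_
    ext w; simp only [mem_filter, mem_erase]; tauto

/-- If a similarity maps many points of `D` into `X`, then it does so for many pairs of points that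
are close to each other in `D` and whose images are close to each other in `X`. -/
lemma card_pow_three_le (D X F : Finset ℂ) (f : ℂ → ℂ) {r : ℝ} (hr : 0 < r)
    (hf : ∀ p p', ‖f p - f p'‖ = r * ‖p - p'‖) (hFD : F ⊆ D) (hFX : ∀ p ∈ F, f p ∈ X) :
    (#F : ℝ) ^ 3 ≤ #F + 64 * #D * #X * ∑ q ∈ F.offDiag,
      (nearCount D q.1 q.2 : ℝ)⁻¹ * (nearCount X (f q.1) (f q.2) : ℝ)⁻¹ := by
  classical
  have hfinj : Function.Injective f := fun p p' e => by
    have := hf p p'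
    rw [e, sub_self, norm_zero, eq_comm, mul_eq_zero] at this
    exact sub_eq_zero.1 (norm_eq_zero.1 (this.resolve_left hr.ne'))
  rcases le_or_gt #F 1 with h1 | h1
  · have hc : (#F : ℝ) ^ 3 ≤ #F := by
      interval_cases #F <;> norm_num
    refine hc.trans (le_add_of_nonneg_right ?_)
    positivity
  have hnn : ∀ p, ∃ p', p ∈ F → p' ∈ F ∧ p' ≠ p ∧ ∀ z ∈ F, p ≠ z → ‖p' - p‖ ≤ ‖p - z‖ := by
    intro p
    by_cases hp : p ∈ F
    · have hne : (F.erase p).Nonempty := by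
        rw [← card_pos, card_erase_of_mem hp]; omega
      obtain ⟨p', hp', hmin⟩ := exists_min_image (F.erase p) (fun z => ‖p - z‖) hne
      refine ⟨p', fun _ => ⟨mem_of_mem_erase hp', ne_of_mem_erase hp', fun z hz hpz => ?_⟩⟩
      rw [norm_sub_rev]
      exact hmin z (mem_erase.2 ⟨hpz.symm, hz⟩)
    · exact ⟨p, fun h => absurd h hp⟩
  choose nn hnn using hnn
  have hD : ∑ p ∈ F, (nearCount D p (nn p) : ℝ) ≤ 8 * #D := by
    exact_mod_cast sum_card_disc_le F D id Function.injective_id.injOn (fun p => ‖nn p - p‖)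
      fun p hp p' hp' hne => (hnn p hp).2.2 p' hp' hne
  have hX : ∑ p ∈ F, (nearCount X (f p) (f (nn p)) : ℝ) ≤ 8 * #X := by
    exact_mod_cast sum_card_disc_le F X f hfinj.injOn (fun p => ‖f (nn p) - f p‖)
      fun p hp p' hp' hne => by
        rw [hf, hf]
        exact mul_le_mul_of_nonneg_left ((hnn p hp).2.2 p' hp' hne) hr.le
  have hhol := sum_pow_three_le_of_pow_three_le F (t := fun _ => 1)
    (a := fun p => (nearCount D p (nn p) : ℝ)) (b := fun p => (nearCount X (f p) (f (nn p)) : ℝ))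
    (c := fun p => (nearCount D p (nn p) : ℝ)⁻¹ * (nearCount X (f p) (f (nn p)) : ℝ)⁻¹)
    (fun _ _ => zero_le_one) (fun _ _ => by positivity) (fun _ _ => by positivity)
    (fun _ _ => by positivity) fun p hp => by
      have h1 : (nearCount D p (nn p) : ℝ) ≠ 0 := by
        exact_mod_cast (nearCount_pos (hFD (hnn p hp).1) (hnn p hp).2.1).ne'
      have h2 : (nearCount X (f p) (f (nn p)) : ℝ) ≠ 0 := by
        exact_mod_cast (nearCount_pos (hFX _ (hnn p hp).1) (hfinj.ne (hnn p hp).2.1)).ne'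
      apply le_of_eq
      field_simp
  have hsum : ∑ p ∈ F, (nearCount D p (nn p) : ℝ)⁻¹ * (nearCount X (f p) (f (nn p)) : ℝ)⁻¹ ≤
      ∑ q ∈ F.offDiag,
        (nearCount D q.1 q.2 : ℝ)⁻¹ * (nearCount X (f q.1) (f q.2) : ℝ)⁻¹ := by
    rw [← sum_image (s := F) (g := fun p => (p, nn p))
      (f := fun q : ℂ × ℂ => (nearCount D q.1 q.2 : ℝ)⁻¹ * (nearCount X (f q.1) (f q.2) : ℝ)⁻¹)
      fun p _ p' _ e => (Prod.ext_iff.1 e).1]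
    refine sum_le_sum_of_subset_of_nonneg ?_ fun _ _ _ => by positivity
    intro q hq
    obtain ⟨p, hp, rfl⟩ := mem_image.1 hq
    exact mem_offDiag.2 ⟨hp, (hnn p hp).1, (hnn p hp).2.1.symm⟩
  simp only [sum_const, nsmul_eq_mul, mul_one] at hhol
  calc (#F : ℝ) ^ 3 ≤ _ := hhol
    _ ≤ (8 * #D) * (8 * #X) * ∑ q ∈ F.offDiag,
        (nearCount D q.1 q.2 : ℝ)⁻¹ * (nearCount X (f q.1) (f q.2) : ℝ)⁻¹ := by gcongr
    _ = 64 * #D * #X * ∑ q ∈ F.offDiag,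
        (nearCount D q.1 q.2 : ℝ)⁻¹ * (nearCount X (f q.1) (f q.2) : ℝ)⁻¹ := by ring
    _ ≤ _ := le_add_of_nonneg_left (by positivity)

/-- Each slope contributes at most `#D * #X` incidences. -/
lemma sum_card_line_le (D X T : Finset ℂ) (x : ℂ) :
    ∑ s ∈ T, #{p ∈ D | s - x * p ∈ X} ≤ #D * #X := by
  classical
  simp_rw [card_filter]
  rw [sum_comm]
  simp_rw [← card_filter]
  rw [← smul_eq_mul, ← sum_const]
  refine sum_le_sum fun p _ => ?_
  refine card_le_card_of_injOn (fun s => s - x * p) (fun s hs => (mem_filter.1 hs).2) ?_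
  exact fun s _ s' _ e => sub_left_injective e

/-- A third moment form of the Szemerédi–Trotter theorem for Cartesian products in `ℂ²`: the map
`p ↦ s - x * p` takes few of the points of `D` into `X` for most pairs `(x, s)`. -/
lemma sum_card_line_pow_three_le (D X P T : Finset ℂ) (hP : (0 : ℂ) ∉ P) :
    ∑ x ∈ P, ∑ s ∈ T, (#{p ∈ D | s - x * p ∈ X} : ℝ) ^ 3 ≤
      #P * (#D * #X) +
        64 * #D ^ 2 * #X ^ 2 * ((harmonic #D : ℝ) * (harmonic #X : ℝ)) := by
  classical
  let F : ℂ × ℂ → Finset ℂ := fun u => {p ∈ D | u.2 - u.1 * p ∈ X}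
  let w : ℂ × ℂ → ℂ × ℂ → ℝ := fun u q => (nearCount D q.1 q.2 : ℝ)⁻¹ *
    (nearCount X (u.2 - u.1 * q.1) (u.2 - u.1 * q.2) : ℝ)⁻¹
  have hpt : ∀ u ∈ P ×ˢ T, (#(F u) : ℝ) ^ 3 ≤
      #(F u) + 64 * #D * #X * ∑ q ∈ (F u).offDiag, w u q := by
    intro u hu
    have hu0 : u.1 ≠ 0 := fun h => hP (h ▸ (mem_product.1 hu).1)
    refine card_pow_three_le D X (F u) (fun p => u.2 - u.1 * p) (norm_pos_iff.2 hu0)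
      (fun p p' => ?_) (filter_subset _ _) (fun p hp => (mem_filter.1 hp).2)
    rw [← norm_mul, ← norm_neg]
    congr 1
    ring
  have hlin : ∑ u ∈ P ×ˢ T, (#(F u) : ℝ) ≤ #P * (#D * #X) := by
    rw [sum_product]
    have : ∀ x ∈ P, ∑ s ∈ T, (#(F (x, s)) : ℝ) ≤ #D * #X := fun x _ => by
      exact_mod_cast sum_card_line_le D X T x
    simpa using sum_le_card_nsmul P _ _ this
  have hpair : ∀ q ∈ D.offDiag, ∑ u ∈ P ×ˢ T with q ∈ (F u).offDiag, w u q ≤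
      (nearCount D q.1 q.2 : ℝ)⁻¹ * (#X * (harmonic #X : ℝ)) := by
    intro q hq
    have hne : q.1 - q.2 ≠ 0 := sub_ne_zero.2 (mem_offDiag.1 hq).2.2
    rw [← mul_sum]
    refine mul_le_mul_of_nonneg_left (le_trans ?_ (sum_offDiag_inv_nearCount_le X))
      (by positivity)
    rw [← sum_image (g := fun u : ℂ × ℂ => (u.2 - u.1 * q.1, u.2 - u.1 * q.2))
      (f := fun v : ℂ × ℂ => (nearCount X v.1 v.2 : ℝ)⁻¹)]
    · refine sum_le_sum_of_subset_of_nonneg ?_ fun _ _ _ => by positivity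
      intro v hv
      obtain ⟨u, hu, rfl⟩ := mem_image.1 hv
      obtain ⟨huPT, huF⟩ := mem_filter.1 hu
      obtain ⟨h1, h2, _⟩ := mem_offDiag.1 huF
      refine mem_offDiag.2 ⟨(mem_filter.1 h1).2, (mem_filter.1 h2).2, fun e => ?_⟩
      have hu0 : u.1 ≠ 0 := fun h => hP (h ▸ (mem_product.1 huPT).1)
      have : u.1 * (q.1 - q.2) = 0 := by linear_combination -e
      exact mul_ne_zero hu0 hne this
    · rintro ⟨x, s⟩ _ ⟨x', s'⟩ _ e
      simp only [Prod.mk.injEq] at e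
      have hx : x = x' := by
        refine mul_right_cancel₀ hne ?_
        linear_combination e.2 - e.1
      subst hx
      simpa using e.1
  have hmain : ∑ u ∈ P ×ˢ T, ∑ q ∈ (F u).offDiag, w u q ≤
      (#D * (harmonic #D : ℝ)) * (#X * (harmonic #X : ℝ)) := by
    rw [sum_comm' (s' := fun q => {u ∈ P ×ˢ T | q ∈ (F u).offDiag}) (t' := D.offDiag)]
    · refine (sum_le_sum hpair).trans ?_
      rw [← sum_mul]
      refine mul_le_mul_of_nonneg_right (sum_offDiag_inv_nearCount_le D) ?_
      have : (0 : ℝ) ≤ (harmonic #X : ℝ) := by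
        exact_mod_cast harmonic_mono (Nat.zero_le _)
      positivity
    · intro u q
      rw [mem_filter]
      refine ⟨fun h => ⟨h, offDiag_mono (filter_subset _ _) h.2⟩, fun h => h.1⟩
  rw [← sum_product' P T fun x s => (#{p ∈ D | s - x * p ∈ X} : ℝ) ^ 3]
  calc _ ≤ ∑ u ∈ P ×ˢ T, ((#(F u) : ℝ) + 64 * #D * #X * ∑ q ∈ (F u).offDiag, w u q) :=
        sum_le_sum hpt
    _ = ∑ u ∈ P ×ˢ T, (#(F u) : ℝ) +
        64 * #D * #X * ∑ u ∈ P ×ˢ T, ∑ q ∈ (F u).offDiag, w u q := by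
        rw [sum_add_distrib, ← mul_sum]
    _ ≤ #P * (#D * #X) +
        64 * #D * #X * ((#D * (harmonic #D : ℝ)) * (#X * (harmonic #X : ℝ))) := by gcongr
    _ = _ := by ring

/-- A nonnegative function has a superlevel set carrying a logarithmic proportion of its mass. -/
lemma exists_sum_le_mul_card_level {ι : Type*} [DecidableEq ι] {C : Finset ι} (hC : C.Nonempty)
    {h : ι → ℝ} (hh : ∀ a ∈ C, 0 ≤ h a) :
    ∃ a₀ ∈ C, ∑ a ∈ C, h a ≤ h a₀ * #{a ∈ C | h a₀ ≤ h a} * (harmonic #C : ℝ) := by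
  obtain ⟨a₀, ha₀, hmax⟩ := exists_max_image C (fun a => h a * #{a' ∈ C | h a ≤ h a'}) hC
  refine ⟨a₀, ha₀, ?_⟩
  have hrank := sum_inv_card_filter_le_harmonic C fun a => -h a
  simp only [neg_le_neg_iff] at hrank
  have hpos : ∀ a ∈ C, (0 : ℝ) < #{a' ∈ C | h a ≤ h a'} := fun a ha => by
    exact_mod_cast card_pos.2 ⟨a, by simp [ha]⟩
  calc ∑ a ∈ C, h a
      = ∑ a ∈ C, h a * #{a' ∈ C | h a ≤ h a'} * (#{a' ∈ C | h a ≤ h a'} : ℝ)⁻¹ :=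
        sum_congr rfl fun a ha => (mul_inv_cancel_right₀ (hpos a ha).ne' _).symm
    _ ≤ ∑ a ∈ C, h a₀ * #{a ∈ C | h a₀ ≤ h a} * (#{a' ∈ C | h a ≤ h a'} : ℝ)⁻¹ :=
        sum_le_sum fun a ha => mul_le_mul_of_nonneg_right (hmax a ha) (by positivity)
    _ ≤ _ := by
        rw [← mul_sum]
        exact mul_le_mul_of_nonneg_left hrank (mul_nonneg (hh a₀ ha₀) (Nat.cast_nonneg _))

/-- The number of representations of `s` as a sum of an element of `B` and one of `X`. -/
noncomputable def sumRep (B X : Finset ℂ) (s : ℂ) : ℕ := #{a ∈ B | s - a ∈ X}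

/-- The number of representations of `x` as a product of two elements of `C`. -/
noncomputable def mulRep (C : Finset ℂ) (x : ℂ) : ℕ := #{u ∈ C ×ˢ C | u.1 * u.2 = x}

lemma addEnergy_le_sum_sumRep_sq {B A : Finset ℂ} (hBA : B ⊆ A) :
    _root_.addEnergy B ≤ ∑ s ∈ A + A, sumRep B A s ^ 2 := by
  classical
  unfold _root_.addEnergy
  rw [card_eq_sum_card_fiberwise (f := fun x => x.1 + x.2.1) (t := A + A)]
  · refine sum_le_sum fun s _ => ?_
    rw [sq, sumRep, ← card_product]
    refine card_le_card_of_injOn (fun x => (x.1, x.2.2.1)) ?_ ?_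
    · intro x hx
      simp only [coe_filter, mem_filter, mem_product, Set.mem_ofPred_eq] at hx
      obtain ⟨⟨⟨h1, h2, h3, h4⟩, he⟩, hs⟩ := hx
      simp only [coe_product, Set.mem_prod, mem_coe, mem_filter]
      refine ⟨⟨h1, ?_⟩, h3, ?_⟩
      · rw [← hs, add_sub_cancel_left]; exact hBA h2
      · rw [← hs, he, add_sub_cancel_left]; exact hBA h4
    · rintro ⟨a, b, a', b'⟩ hx ⟨c, d, c', d'⟩ hy e
      simp only [coe_filter, mem_filter, mem_product, Set.mem_ofPred_eq] at hx hy
      simp only [Prod.mk.injEq] at e ⊢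
      obtain ⟨rfl, rfl⟩ := e
      refine ⟨rfl, ?_, rfl, ?_⟩
      · exact add_left_cancel (hx.2.trans hy.2.symm)
      · exact add_left_cancel (hx.1.2.symm.trans (hx.2.trans (hy.2.symm.trans hy.1.2)))
  · intro x hx
    simp only [coe_filter, mem_product, Set.mem_ofPred_eq] at hx
    exact add_mem_add (hBA hx.1.1) (hBA hx.1.2.1)

lemma mulEnergy_le_sum_mulRep_sq (C : Finset ℂ) :
    _root_.mulEnergy C ≤
      4 * #C ^ 2 + ∑ x ∈ C.erase 0 * C.erase 0, mulRep (C.erase 0) x ^ 2 := by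
  classical
  unfold _root_.mulEnergy
  rw [← card_filter_add_card_filter_not (fun x => x.1 * x.2.1 = 0)]
  refine add_le_add ?_ ?_
  · let Z := {u ∈ C ×ˢ C | u.1 * u.2 = 0}
    have hZ : #Z ≤ 2 * #C := by
      have : Z ⊆ {0} ×ˢ C ∪ C ×ˢ {0} := by
        rintro ⟨a, b⟩ hu
        simp only [Z, mem_filter, mem_product, mul_eq_zero] at hu
        simp only [mem_union, mem_product, mem_singleton]
        tauto
      refine (card_le_card this).trans ((card_union_le _ _).trans ?_)
      simp only [card_product, card_singleton]
      omega
    calc _ ≤ #(Z ×ˢ Z) := by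
          refine card_le_card_of_injOn (fun x => ((x.1, x.2.1), (x.2.2.1, x.2.2.2))) ?_ ?_
          · intro x hx
            simp only [coe_filter, mem_filter, mem_product, Set.mem_ofPred_eq] at hx
            obtain ⟨⟨⟨h1, h2, h3, h4⟩, he⟩, hs⟩ := hx
            simp only [coe_product, Set.mem_prod, mem_coe, Z, mem_filter, mem_product]
            exact ⟨⟨⟨h1, h2⟩, hs⟩, ⟨h3, h4⟩, he ▸ hs⟩
          · rintro ⟨a, b, a', b'⟩ _ ⟨c, d, c', d'⟩ _ e
            simp only [Prod.mk.injEq] at e ⊢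
            tauto
      _ ≤ 4 * #C ^ 2 := by
          rw [card_product]
          nlinarith
  · rw [card_eq_sum_card_fiberwise (f := fun x => x.1 * x.2.1) (t := C.erase 0 * C.erase 0)]
    · refine sum_le_sum fun s hs0 => ?_
      have hs0 : s ≠ 0 := by
        obtain ⟨a, ha, b, hb, rfl⟩ := mem_mul.1 hs0
        exact mul_ne_zero (ne_of_mem_erase ha) (ne_of_mem_erase hb)
      rw [sq, mulRep, ← card_product]
      refine card_le_card_of_injOn (fun x => ((x.1, x.2.1), (x.2.2.1, x.2.2.2))) ?_ ?_
      · intro x hx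
        simp only [coe_filter, mem_filter, mem_product, Set.mem_ofPred_eq] at hx
        obtain ⟨⟨⟨⟨h1, h2, h3, h4⟩, he⟩, _⟩, hs⟩ := hx
        have hne := hs ▸ hs0
        have hne' := he ▸ hne
        simp only [coe_product, Set.mem_prod, mem_coe, mem_filter, mem_product, mem_erase]
        exact ⟨⟨⟨⟨left_ne_zero_of_mul hne, h1⟩, right_ne_zero_of_mul hne, h2⟩, hs⟩,
          ⟨⟨left_ne_zero_of_mul hne', h3⟩, right_ne_zero_of_mul hne', h4⟩, he ▸ hs⟩
      · rintro ⟨a, b, a', b'⟩ _ ⟨c, d, c', d'⟩ _ e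
        simp only [Prod.mk.injEq] at e ⊢
        tauto
    · intro x hx
      simp only [coe_filter, mem_filter, mem_product, Set.mem_ofPred_eq] at hx
      exact mul_mem_mul (mem_erase.2 ⟨left_ne_zero_of_mul hx.2, hx.1.1.1⟩)
        (mem_erase.2 ⟨right_ne_zero_of_mul hx.2, hx.1.1.2.1⟩)

lemma one_le_harmonic {n : ℕ} (hn : n ≠ 0) : (1 : ℝ) ≤ (harmonic n : ℝ) := by
  have := harmonic_mono (Nat.one_le_iff_ne_zero.2 hn)
  rw [show harmonic 1 = 1 by simp [harmonic]] at this
  exact_mod_cast this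

lemma sum_mulRep_mul (C : Finset ℂ) (g : ℂ → ℝ) :
    ∑ x ∈ C * C, mulRep C x * g x = ∑ a ∈ C, ∑ b ∈ C, g (a * b) := by
  classical
  rw [← sum_product' C C fun a b => g (a * b),
    ← sum_fiberwise_of_maps_to (t := C * C) (g := fun u : ℂ × ℂ => u.1 * u.2)]
  · refine sum_congr rfl fun x _ => ?_
    rw [sum_congr rfl (g := fun _ => g x) fun u hu => by rw [(mem_filter.1 hu).2],
      sum_const, nsmul_eq_mul, mulRep]
  · exact fun u hu => mul_mem_mul (mem_product.1 hu).1 (mem_product.1 hu).2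

lemma sum_sumRep_le (B X T : Finset ℂ) : ∑ s ∈ T, (sumRep B X s : ℝ) ≤ #B * #X := by
  have := sum_card_line_le B X T 1
  simp only [one_mul] at this
  exact_mod_cast this

/-- Representations of `s` as a sum, with the first summand in a superlevel set of
`a ↦ ∑ b ∈ C, mulRep C (a * b)`, give rise to incidences. -/
lemma mul_sumRep_filter_le {C : Finset ℂ} (h0 : (0 : ℂ) ∉ C) (X : Finset ℂ) (q : ℝ) (s : ℂ) :
    q * sumRep {a ∈ C | q ≤ ∑ b ∈ C, (mulRep C (a * b) : ℝ)} X s ≤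
      ∑ x ∈ C * C, (mulRep C x : ℝ) * #{p ∈ C.image fun b => b⁻¹ | s - x * p ∈ X} := by
  classical
  set C₁ : Finset ℂ := {a ∈ C | q ≤ ∑ b ∈ C, (mulRep C (a * b) : ℝ)}
  calc q * sumRep C₁ X s = ∑ a ∈ C₁ with s - a ∈ X, q := by
        rw [sum_const, nsmul_eq_mul, mul_comm, sumRep]
    _ ≤ ∑ a ∈ C₁ with s - a ∈ X, ∑ b ∈ C, (mulRep C (a * b) : ℝ) :=
        sum_le_sum fun a ha => (mem_filter.1 (mem_filter.1 ha).1).2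
    _ ≤ ∑ a ∈ C with s - a ∈ X, ∑ b ∈ C, (mulRep C (a * b) : ℝ) :=
        sum_le_sum_of_subset_of_nonneg (filter_subset_filter _ (filter_subset _ _))
          fun _ _ _ => sum_nonneg fun _ _ => by positivity
    _ = ∑ b ∈ C, ∑ a ∈ C with s - a ∈ X, (mulRep C (a * b) : ℝ) := sum_comm
    _ ≤ ∑ b ∈ C, ∑ x ∈ C * C with s - x * b⁻¹ ∈ X, (mulRep C x : ℝ) := by
        refine sum_le_sum fun b hb => ?_
        have hb0 : b ≠ 0 := fun e => h0 (e ▸ hb)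
        rw [← sum_image (s := {a ∈ C | s - a ∈ X}) (g := fun a => a * b)
          (f := fun x => (mulRep C x : ℝ)) (mul_left_injective₀ hb0).injOn]
        refine sum_le_sum_of_subset_of_nonneg ?_ fun _ _ _ => by positivity
        intro x hx
        obtain ⟨a, ha, rfl⟩ := mem_image.1 hx
        rw [mem_filter] at ha ⊢
        rw [mul_inv_cancel_right₀ hb0]
        exact ⟨mul_mem_mul ha.1 hb, ha.2⟩
    _ = ∑ x ∈ C * C, ∑ b ∈ C with s - x * b⁻¹ ∈ X, (mulRep C x : ℝ) := by
        simp_rw [sum_filter]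
        exact sum_comm
    _ = _ := by
        refine sum_congr rfl fun x _ => ?_
        rw [sum_const, nsmul_eq_mul, mul_comm, filter_image,
          card_image_of_injective _ inv_injective]

/-- A set with many multiplicative coincidences contains a nonempty subset that has few additive
coincidences with any given larger set. -/
lemma exists_subset_sum_sumRep_sq_le {C X : Finset ℂ} (hC : C.Nonempty) (h0 : (0 : ℂ) ∉ C)
    (hCX : C ⊆ X) (T : Finset ℂ) :
    ∃ C₁ ⊆ C, C₁.Nonempty ∧
      (∑ s ∈ T, (sumRep C₁ X s : ℝ) ^ 2) ^ 2 * (∑ x ∈ C * C, (mulRep C x : ℝ) ^ 2) ^ 2 ≤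
        65 * (harmonic #X : ℝ) ^ 5 * #C₁ ^ 4 * #X ^ 7 := by
  classical
  set E : ℝ := ∑ x ∈ C * C, (mulRep C x : ℝ) ^ 2 with hE
  set H : ℝ := (harmonic #X : ℝ)
  set D : Finset ℂ := C.image fun b => b⁻¹ with hD
  have hDcard : #D = #C := card_image_of_injective C inv_injective
  have hX : X.Nonempty := hC.mono hCX
  have hH1 : 1 ≤ H := one_le_harmonic hX.card_pos.ne'
  have hHC : (harmonic #C : ℝ) ≤ H := Rat.cast_le.2 (harmonic_mono (card_le_card hCX))
  have hHC0 : (0 : ℝ) ≤ (harmonic #C : ℝ) :=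
    zero_le_one.trans (one_le_harmonic hC.card_pos.ne')
  have hmn : (#C : ℝ) ≤ #X := by exact_mod_cast card_le_card hCX
  have hEpos : 0 < E := by
    refine sum_pos (fun x hx => ?_) (hC.mul hC)
    obtain ⟨a, ha, b, hb, rfl⟩ := mem_mul.1 hx
    have : 0 < mulRep C (a * b) := card_pos.2 ⟨(a, b), by simp [ha, hb]⟩
    positivity
  let h : ℂ → ℝ := fun a => ∑ b ∈ C, (mulRep C (a * b) : ℝ)
  have hsumh : ∑ a ∈ C, h a = E := by
    rw [hE, ← sum_mulRep_mul C fun x => (mulRep C x : ℝ)]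
    exact sum_congr rfl fun x _ => (sq _).symm
  have hsumg : ∑ x ∈ C * C, (mulRep C x : ℝ) = (#C : ℝ) ^ 2 := by
    have := sum_mulRep_mul C fun _ => 1
    simp only [mul_one, sum_const, nsmul_eq_mul] at this
    rw [this, sq]
  obtain ⟨a₀, ha₀, hlev⟩ := exists_sum_le_mul_card_level hC (h := h)
    fun _ _ => sum_nonneg fun _ _ => by positivity
  rw [hsumh] at hlev
  set C₁ : Finset ℂ := {a ∈ C | h a₀ ≤ h a} with hC₁
  set q : ℝ := h a₀ with hq
  have hq0 : 0 ≤ q := sum_nonneg fun _ _ => by positivity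
  refine ⟨C₁, filter_subset _ _, ⟨a₀, by simp [hC₁, ha₀, hq]⟩, ?_⟩
  have hR : ∀ s, q * sumRep C₁ X s ≤
      ∑ x ∈ C * C, (mulRep C x : ℝ) * #{p ∈ D | s - x * p ∈ X} := fun s =>
    mul_sumRep_filter_le h0 X q s
  have hP0 : (0 : ℂ) ∉ C * C := by
    intro hx
    obtain ⟨a, ha, b, hb, e⟩ := mem_mul.1 hx
    rcases mul_eq_zero.1 e with rfl | rfl
    · exact h0 ha
    · exact h0 hb
  have hW : ∑ x ∈ C * C, ∑ s ∈ T, (#{p ∈ D | s - x * p ∈ X} : ℝ) ^ 3 ≤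
      65 * #C ^ 2 * #X ^ 2 * H ^ 2 := by
    refine (sum_card_line_pow_three_le D X (C * C) T hP0).trans ?_
    rw [hDcard]
    have hcc : (#(C * C) : ℝ) ≤ #C * #C := by exact_mod_cast card_mul_le
    calc (#(C * C) : ℝ) * (#C * #X) + 64 * #C ^ 2 * #X ^ 2 * ((harmonic #C : ℝ) * H)
        ≤ (#C * #C) * (#X * #X) * 1 + 64 * #C ^ 2 * #X ^ 2 * (H * H) := by
          rw [mul_one]; gcongr
      _ ≤ (#C * #C) * (#X * #X) * (H * H) + 64 * #C ^ 2 * #X ^ 2 * (H * H) := by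
          gcongr
          nlinarith
      _ = _ := by ring
  have hthird : q ^ 3 * ∑ s ∈ T, (sumRep C₁ X s : ℝ) ^ 3 ≤
      #C ^ 2 * E * (65 * #C ^ 2 * #X ^ 2 * H ^ 2) := by
    rw [mul_sum]
    calc ∑ s ∈ T, q ^ 3 * (sumRep C₁ X s : ℝ) ^ 3
        ≤ ∑ s ∈ T, #C ^ 2 * E * ∑ x ∈ C * C, (#{p ∈ D | s - x * p ∈ X} : ℝ) ^ 3 := by
          refine sum_le_sum fun s _ => ?_
          rw [← mul_pow, ← hsumg]
          refine (pow_le_pow_left₀ (by positivity) (hR s) 3).trans ?_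
          refine sum_pow_three_le_of_pow_three_le _ (fun _ _ => by positivity)
            (fun _ _ => by positivity) (fun _ _ => by positivity) (fun _ _ => by positivity) ?_
          intro x _
          apply le_of_eq
          ring
      _ = #C ^ 2 * E * ∑ x ∈ C * C, ∑ s ∈ T, (#{p ∈ D | s - x * p ∈ X} : ℝ) ^ 3 := by
          rw [← mul_sum, sum_comm]
      _ ≤ _ := by gcongr
  have hcs : (∑ s ∈ T, (sumRep C₁ X s : ℝ) ^ 2) ^ 2 ≤
      (#C₁ * #X) * ∑ s ∈ T, (sumRep C₁ X s : ℝ) ^ 3 := by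
    refine (sum_sq_le_sum_mul_sum_of_sq_le_mul T (f := fun s => (sumRep C₁ X s : ℝ))
      (g := fun s => (sumRep C₁ X s : ℝ) ^ 3) (fun _ _ => by positivity)
      (fun _ _ => by positivity) fun s _ => le_of_eq (by ring)).trans ?_
    gcongr
    exact sum_sumRep_le C₁ X T
  set V : ℝ := ∑ s ∈ T, (sumRep C₁ X s : ℝ) ^ 2
  set R : ℝ := ∑ s ∈ T, (sumRep C₁ X s : ℝ) ^ 3
  have hlev' : E ≤ q * #C₁ * H := hlev.trans (by gcongr)
  have hR0 : 0 ≤ R := sum_nonneg fun _ _ => by positivity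
  clear_value V R E H q C₁ D
  refine le_of_mul_le_mul_right ?_ hEpos
  calc V ^ 2 * E ^ 2 * E = V ^ 2 * E ^ 3 := by ring
    _ ≤ ((#C₁ * #X) * R) * (q * #C₁ * H) ^ 3 :=
        mul_le_mul hcs (pow_le_pow_left₀ hEpos.le hlev' 3) (by positivity) (by positivity)
    _ = #C₁ ^ 4 * #X * H ^ 3 * (q ^ 3 * R) := by ring
    _ ≤ #C₁ ^ 4 * #X * H ^ 3 * (#C ^ 2 * E * (65 * #C ^ 2 * #X ^ 2 * H ^ 2)) :=
        mul_le_mul_of_nonneg_left hthird (by positivity)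
    _ = 65 * H ^ 5 * #C₁ ^ 4 * #X ^ 3 * E * #C ^ 4 := by ring
    _ ≤ 65 * H ^ 5 * #C₁ ^ 4 * #X ^ 3 * E * #X ^ 4 :=
        mul_le_mul_of_nonneg_left (pow_le_pow_left₀ (by positivity) hmn 4) (by positivity)
    _ = _ := by ring

lemma sumRep_union {B C : Finset ℂ} (h : Disjoint B C) (X : Finset ℂ) (s : ℂ) :
    sumRep (B ∪ C) X s = sumRep B X s + sumRep C X s := by
  rw [sumRep, filter_union, card_union_of_disjoint (disjoint_filter_filter h)]
  rfl

/-- Minkowski's inequality in the form used for unions of sets. -/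
lemma sum_add_sq_le {ι : Type*} (T : Finset ι) {u v : ι → ℝ} {b c M : ℝ} (hb : 0 ≤ b)
    (hc : 0 ≤ c) (hM : 0 ≤ M) (hu : ∑ s ∈ T, u s ^ 2 ≤ b ^ 2 * M)
    (hv : ∑ s ∈ T, v s ^ 2 ≤ c ^ 2 * M) :
    ∑ s ∈ T, (u s + v s) ^ 2 ≤ (b + c) ^ 2 * M := by
  have huv : ∑ s ∈ T, u s * v s ≤ b * c * M := by
    refine le_of_abs_le (abs_le_of_sq_le_sq ?_ (by positivity))
    calc (∑ s ∈ T, u s * v s) ^ 2 ≤ (∑ s ∈ T, u s ^ 2) * ∑ s ∈ T, v s ^ 2 :=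
          sum_mul_sq_le_sq_mul_sq T u v
      _ ≤ (b ^ 2 * M) * (c ^ 2 * M) :=
          mul_le_mul hu hv (sum_nonneg fun _ _ => sq_nonneg _) (by positivity)
      _ = (b * c * M) ^ 2 := by ring
  have : ∑ s ∈ T, (u s + v s) ^ 2 =
      ∑ s ∈ T, u s ^ 2 + 2 * ∑ s ∈ T, u s * v s + ∑ s ∈ T, v s ^ 2 := by
    rw [mul_sum, ← sum_add_distrib, ← sum_add_distrib]
    exact sum_congr rfl fun _ _ => by ring
  rw [this]
  nlinarith

/-- Every finite set splits into a part with few additive coincidences and one with few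
multiplicative coincidences. -/
lemma exists_subset_sumRep_mulRep_le (A : Finset ℂ) (hA : A.Nonempty) :
    ∃ B ⊆ A, ∑ s ∈ A + A, (sumRep B A s : ℝ) ^ 2 ≤
        #B ^ 2 * (9 * (harmonic #A : ℝ) ^ 3 * (#A : ℝ) ^ (3 / 4 : ℝ)) ∧
      ∑ x ∈ (A \ B).erase 0 * (A \ B).erase 0, (mulRep ((A \ B).erase 0) x : ℝ) ^ 2 ≤
        (#A : ℝ) ^ (11 / 4 : ℝ) := by
  classical
  set H : ℝ := (harmonic #A : ℝ)
  set n : ℝ := (#A : ℝ)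
  have hn : 0 < n := Nat.cast_pos.2 hA.card_pos
  have hH : 1 ≤ H := one_le_harmonic hA.card_pos.ne'
  set M : ℝ := 9 * H ^ 3 * n ^ (3 / 4 : ℝ) with hM
  have hM0 : 0 ≤ M := by positivity
  obtain ⟨B, hB, hmax⟩ := exists_max_image
    {B ∈ A.powerset | ∑ s ∈ A + A, (sumRep B A s : ℝ) ^ 2 ≤ #B ^ 2 * M} card
    ⟨∅, mem_filter.2 ⟨empty_mem_powerset A, by simp [sumRep]⟩⟩
  obtain ⟨hBA, hBM⟩ := mem_filter.1 hB
  rw [mem_powerset] at hBA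
  refine ⟨B, hBA, hBM, ?_⟩
  by_contra! hE
  set C : Finset ℂ := (A \ B).erase 0
  set E : ℝ := ∑ x ∈ C * C, (mulRep C x : ℝ) ^ 2
  have he : 0 < n ^ (11 / 4 : ℝ) := by positivity
  have hCA : C ⊆ A := (erase_subset _ _).trans sdiff_subset
  have hCne : C.Nonempty := by
    rw [nonempty_iff_ne_empty]
    intro h
    simp only [E, h, mul_empty, sum_empty] at hE
    exact absurd hE (not_lt.2 he.le)
  obtain ⟨C₁, hC₁C, hC₁, hV⟩ :=
    exists_subset_sum_sumRep_sq_le hCne (notMem_erase _ _) hCA (A + A)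
  have hdisj : Disjoint B C₁ := by
    refine disjoint_of_subset_right (hC₁C.trans (erase_subset _ _)) disjoint_sdiff
  have hVM : ∑ s ∈ A + A, (sumRep C₁ A s : ℝ) ^ 2 ≤ #C₁ ^ 2 * M := by
    set V : ℝ := ∑ s ∈ A + A, (sumRep C₁ A s : ℝ) ^ 2
    have hV0 : 0 ≤ V := sum_nonneg fun _ _ => by positivity
    have hen : (n ^ (11 / 4 : ℝ) * n ^ (3 / 4 : ℝ)) ^ 2 = n ^ 7 := by
      rw [← Real.rpow_add hn, ← Real.rpow_natCast, ← Real.rpow_mul hn.le, ← Real.rpow_natCast]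
      norm_num
    have hVE : V * E ≤ #C₁ ^ 2 * M * n ^ (11 / 4 : ℝ) := by
      refine le_of_abs_le (abs_le_of_sq_le_sq ?_ (by positivity))
      calc (V * E) ^ 2 = V ^ 2 * E ^ 2 := by ring
        _ ≤ 65 * H ^ 5 * #C₁ ^ 4 * n ^ 7 := hV
        _ ≤ 81 * H ^ 6 * #C₁ ^ 4 * n ^ 7 := by
            have : H ^ 5 ≤ H ^ 6 := pow_le_pow_right₀ hH (by norm_num)
            gcongr
            norm_num
        _ = _ := by rw [← hen, hM]; ring
    refine le_of_mul_le_mul_right (le_trans ?_ hVE) he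
    gcongr
  have hmem : B ∪ C₁ ∈ {B ∈ A.powerset | ∑ s ∈ A + A, (sumRep B A s : ℝ) ^ 2 ≤ #B ^ 2 * M} := by
    rw [mem_filter, mem_powerset, card_union_of_disjoint hdisj]
    refine ⟨union_subset hBA (hC₁C.trans hCA), ?_⟩
    simp only [sumRep_union hdisj]
    push_cast
    exact sum_add_sq_le _ (by positivity) (by positivity) hM0 hBM hVM
  have := hmax _ hmem
  rw [card_union_of_disjoint hdisj] at this
  have := hC₁.card_pos
  omega

end

theorem rss_energy_sum_product_complex :
    ∃ C > (0 : ℝ), ∃ c ≥ (0 : ℝ), ∀ A : Finset ℂ, 2 ≤ A.card →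
      ∃ A' ⊆ A, (A.card : ℝ) / 2 ≤ A'.card ∧
        (min (addEnergy A') (mulEnergy A') : ℝ) ≤
          C * (A.card : ℝ) ^ ((3 : ℝ) - 1 / 4) * (Real.log A.card) ^ c := by
  refine ⟨243, by norm_num, 3, by norm_num, fun A hA => ?_⟩
  have hA0 : A.Nonempty := Finset.card_pos.1 (by omega)
  obtain ⟨B, hBA, hadd, hmul⟩ := exists_subset_sumRep_mulRep_le A hA0
  have hn : (2 : ℝ) ≤ A.card := by exact_mod_cast hA
  have hlog : 0.69 < Real.log A.card :=
    (by linarith [Real.log_two_gt_d9] : (0.69 : ℝ) < Real.log 2).trans_le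
      (Real.log_le_log (by norm_num) hn)
  have hH : (harmonic A.card : ℝ) ≤ 3 * Real.log A.card := by
    have := harmonic_le_one_add_log A.card
    linarith
  have hH0 : (0 : ℝ) ≤ (harmonic A.card : ℝ) :=
    zero_le_one.trans (one_le_harmonic hA0.card_pos.ne')
  rw [show (3 : ℝ) - 1 / 4 = 11 / 4 by norm_num, Real.rpow_ofNat]
  have hexp : (A.card : ℝ) ^ 2 * (A.card : ℝ) ^ (3 / 4 : ℝ) = (A.card : ℝ) ^ (11 / 4 : ℝ) := by
    rw [← Real.rpow_natCast, ← Real.rpow_add (by linarith)]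
    norm_num
  have hsq : (A.card : ℝ) ^ 2 ≤ (A.card : ℝ) ^ (11 / 4 : ℝ) := by
    rw [← Real.rpow_natCast]
    exact Real.rpow_le_rpow_of_exponent_le (by linarith) (by norm_num)
  rcases le_total ((A.card : ℝ) / 2) B.card with hB | hB
  · refine ⟨B, hBA, hB, (min_le_left _ _).trans ?_⟩
    have hBn : (B.card : ℝ) ≤ A.card := by exact_mod_cast Finset.card_le_card hBA
    have hle : (addEnergy B : ℝ) ≤ _ := Nat.cast_le.2 (addEnergy_le_sum_sumRep_sq hBA)
    push_cast at hle
    calc (addEnergy B : ℝ)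
        ≤ B.card ^ 2 * (9 * (harmonic A.card : ℝ) ^ 3 * (A.card : ℝ) ^ (3 / 4 : ℝ)) :=
          hle.trans hadd
      _ ≤ A.card ^ 2 * (9 * (3 * Real.log A.card) ^ 3 * (A.card : ℝ) ^ (3 / 4 : ℝ)) := by
          gcongr
      _ = 243 * ((A.card : ℝ) ^ 2 * (A.card : ℝ) ^ (3 / 4 : ℝ)) * Real.log A.card ^ 3 := by ring
      _ = _ := by rw [hexp]
  · have hcard : ((A \ B).card : ℝ) = A.card - B.card := by
      rw [Finset.card_sdiff_of_subset hBA, Nat.cast_sub (Finset.card_le_card hBA)]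
    refine ⟨A \ B, Finset.sdiff_subset, by rw [hcard]; linarith, (min_le_right _ _).trans ?_⟩
    have hCn : ((A \ B).card : ℝ) ≤ A.card := by rw [hcard]; simp
    have hle : (mulEnergy (A \ B) : ℝ) ≤ _ := Nat.cast_le.2 (mulEnergy_le_sum_mulRep_sq (A \ B))
    push_cast at hle
    have hlog3 : 0.69 ^ 3 ≤ Real.log A.card ^ 3 := pow_le_pow_left₀ (by norm_num) hlog.le 3
    calc (mulEnergy (A \ B) : ℝ) ≤ 4 * (A.card : ℝ) ^ 2 + (A.card : ℝ) ^ (11 / 4 : ℝ) :=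
          hle.trans (by gcongr)
      _ ≤ 5 * (A.card : ℝ) ^ (11 / 4 : ℝ) := by linarith
      _ ≤ 243 * Real.log A.card ^ 3 * (A.card : ℝ) ^ (11 / 4 : ℝ) := by
          gcongr
          linarith
      _ = _ := by ring
end
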